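/- arXiv:2310.12831 — 9 statements merged into one kernel-verified Lean document; each statement's English description precedes it below -/
import Mathlib

section
/- If the surrogate stability conditions hold, then y_g is a globally asymptotically stable equilibrium of Φ on 𝓛. -/
open Metric Set Filter Topology

noncomputable def deltaFn {m : ℕ} (yg : EuclideanSpace ℝ (Fin m))
    (Φ : ℝ → EuclideanSpace ℝ (Fin m) → EuclideanSpace ℝ (Fin m))
    (y₀ : EuclideanSpace ℝ (Fin m)) (t : ℝ) : ℝ :=
  ‖yg - Φ t y₀‖

theorem tendsto_dist_iterate_zero_of_dist_lt {X : Type*} [PseudoMetricSpace X] {s : Set X}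
    (hs : IsCompact s) {P : X → X} (hP : ContinuousOn P s) (hmaps : MapsTo P s s) {a : X}
    (hlt : ∀ x ∈ s, x ≠ a → dist (P x) a < dist x a) (ha : dist (P a) a = 0)
    {x : X} (hx : x ∈ s) :
    Tendsto (fun n => dist (P^[n] x) a) atTop (𝓝 0) := by
  have hmem (n : ℕ) : P^[n] x ∈ s := hmaps.iterate n hx
  have hle : ∀ y ∈ s, dist (P y) a ≤ dist y a := by
    intro y hy
    by_cases h : y = a
    · simp [h, ha]
    · exact (hlt y hy h).le
  have hanti : Antitone fun n => dist (P^[n] x) a := by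
    refine antitone_nat_of_succ_le fun n => ?_
    rw [Function.iterate_succ_apply']
    exact hle _ (hmem n)
  have hlim := tendsto_atTop_ciInf hanti
    ⟨0, by rintro _ ⟨n, rfl⟩; exact dist_nonneg⟩
  obtain ⟨p, hp, φ, hφ, hconv⟩ := hs.tendsto_subseq hmem
  have h₁ : Tendsto (fun n => dist (P^[φ n] x) a) atTop (𝓝 (dist p a)) :=
    hconv.dist tendsto_const_nhds
  have h₂ : Tendsto (fun n => dist (P^[φ n + 1] x) a) atTop (𝓝 (dist (P p) a)) := by
    simp only [Function.iterate_succ_apply']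
    exact ((hP p hp).tendsto.comp (tendsto_nhdsWithin_iff.2
      ⟨hconv, Eventually.of_forall fun n => hmem _⟩)).dist tendsto_const_nhds
  have e₁ := tendsto_nhds_unique h₁ (hlim.comp hφ.tendsto_atTop)
  have e₂ := tendsto_nhds_unique h₂
    (hlim.comp ((tendsto_add_atTop_nat 1).comp hφ.tendsto_atTop))
  have hpa : p = a := by
    by_contra h
    exact (hlt p hp h).ne (e₂.trans e₁.symm)
  rw [hpa, dist_self] at e₁
  rwa [← e₁] at hlim

theorem exists_dist_semiflow_le {E : Type*} [NormedAddCommGroup E] [NormedSpace ℝ E]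
    {s : Set E} (hs : IsCompact s) (hconv : Convex ℝ s) {f : E → E} (hf : ContDiff ℝ 1 f)
    {Φ : ℝ → E → E} (hΦ0 : ∀ x ∈ s, Φ 0 x = x)
    (hΦinv : ∀ t : ℝ, 0 ≤ t → ∀ x ∈ s, Φ t x ∈ s)
    (hΦderiv : ∀ t : ℝ, 0 ≤ t → ∀ x ∈ s, HasDerivAt (fun τ => Φ τ x) (f (Φ t x)) t) (T : ℝ) :
    ∃ C : ℝ, 0 < C ∧ ∀ t ∈ Icc 0 T, ∀ x ∈ s, ∀ y ∈ s, dist (Φ t x) (Φ t y) ≤ C * dist x y := by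
  obtain ⟨K, hK⟩ := hf.contDiffOn.exists_lipschitzOnWith one_ne_zero hconv hs
  refine ⟨Real.exp (K * T), Real.exp_pos _, fun t ht x hx y hy => ?_⟩
  have hcont : ∀ z ∈ s, ContinuousOn (fun τ => Φ τ z) (Icc 0 T) := fun z hz τ hτ =>
    (hΦderiv τ hτ.1 z hz).continuousAt.continuousWithinAt
  have h := dist_le_of_trajectories_ODE_of_mem (v := fun _ => f) (s := fun _ => s)
    (fun _ _ => hK) (hcont x hx) (fun τ hτ => (hΦderiv τ hτ.1 x hx).hasDerivWithinAt)
    (fun τ hτ => hΦinv τ hτ.1 x hx)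
    (hcont y hy) (fun τ hτ => (hΦderiv τ hτ.1 y hy).hasDerivWithinAt)
    (fun τ hτ => hΦinv τ hτ.1 y hy)
    (by rw [hΦ0 x hx, hΦ0 y hy]) t ht
  refine h.trans ?_
  rw [mul_comm, sub_zero]
  gcongr
  exact ht.2

theorem stmt_2
    (m : ℕ) (hm : 1 ≤ m)
    (yg : EuclideanSpace ℝ (Fin m)) (D : ℝ) (hD : 0 < D)
    (f : EuclideanSpace ℝ (Fin m) → EuclideanSpace ℝ (Fin m))
    (hf : ContDiff ℝ 1 f)
    (Φ : ℝ → EuclideanSpace ℝ (Fin m) → EuclideanSpace ℝ (Fin m))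
    (hΦ0 : ∀ y₀ ∈ Metric.closedBall yg D, Φ 0 y₀ = y₀)
    (hΦinv : ∀ t : ℝ, 0 ≤ t → ∀ y₀ ∈ Metric.closedBall yg D,
      Φ t y₀ ∈ Metric.closedBall yg D)
    (hΦderiv : ∀ t : ℝ, 0 ≤ t → ∀ y₀ ∈ Metric.closedBall yg D,
      HasDerivAt (fun τ => Φ τ y₀) (f (Φ t y₀)) t)
    (hΦflow : ∀ s : ℝ, 0 ≤ s → ∀ t : ℝ, 0 ≤ t → ∀ y₀ ∈ Metric.closedBall yg D,
      Φ (s + t) y₀ = Φ t (Φ s y₀))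
    (Δt : ℝ) (hΔt : 0 < Δt)
    (hsur1 : ∀ t : ℝ, 0 ≤ t → deltaFn yg Φ yg (t + Δt) = deltaFn yg Φ yg t)
    (hsur2 : ∀ t : ℝ, 0 ≤ t → ∀ y₀ ∈ Metric.closedBall yg D, y₀ ≠ yg →
      deltaFn yg Φ y₀ (t + Δt) < deltaFn yg Φ y₀ t)
    :
    (∀ t : ℝ, 0 ≤ t → Φ t yg = yg) ∧
    (∀ ε : ℝ, 0 < ε → ∃ η : ℝ, 0 < η ∧ ∀ y₀ ∈ Metric.closedBall yg D,
      ‖yg - y₀‖ < η → ∀ t : ℝ, 0 ≤ t → ‖yg - Φ t y₀‖ < ε) ∧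
    (∀ y₀ ∈ Metric.closedBall yg D,
      Filter.Tendsto (fun t => ‖yg - Φ t y₀‖) Filter.atTop (𝓝 0)) := by
  simp only [deltaFn] at hsur1 hsur2
  have hyg : yg ∈ closedBall yg D := mem_closedBall_self hD.le
  have hper : Φ Δt yg = yg := by
    have h := hsur1 0 le_rfl
    rw [zero_add, hΦ0 yg hyg, sub_self, norm_zero, norm_eq_zero, sub_eq_zero] at h
    exact h.symm
  have heq : ∀ t : ℝ, 0 ≤ t → Φ t yg = yg := by
    intro t ht
    by_contra hne
    have hmem := hΦinv t ht yg hyg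
    have h := hsur2 0 le_rfl _ hmem hne
    rw [zero_add, hΦ0 _ hmem, ← hΦflow t ht Δt hΔt.le yg hyg, add_comm,
      hΦflow Δt hΔt.le t ht yg hyg, hper] at h
    exact h.false
  obtain ⟨C, hC, hCle⟩ := exists_dist_semiflow_le (isCompact_closedBall yg D)
    (convex_closedBall yg D) hf hΦ0 hΦinv hΦderiv Δt
  have hiter : ∀ y₀ ∈ closedBall yg D, ∀ n : ℕ,
      Φ (n * Δt) y₀ = (Φ Δt)^[n] y₀ := by
    intro y₀ hy₀ n
    induction n with
    | zero => simpa using hΦ0 y₀ hy₀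
    | succ n ih =>
      rw [Function.iterate_succ_apply', ← ih, ← hΦflow _ (by positivity) Δt hΔt.le y₀ hy₀]
      push_cast
      ring_nf
  have hmaps : MapsTo (Φ Δt) (closedBall yg D) (closedBall yg D) := hΦinv Δt hΔt.le
  have hlt : ∀ y ∈ closedBall yg D, y ≠ yg → dist (Φ Δt y) yg < dist y yg := by
    intro y hy hne
    have h := hsur2 0 le_rfl y hy hne
    rwa [zero_add, hΦ0 y hy, ← dist_eq_norm, ← dist_eq_norm, dist_comm yg, dist_comm yg] at h
  have hbound : ∀ y₀ ∈ closedBall yg D, ∀ t : ℝ, 0 ≤ t →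
      ‖yg - Φ t y₀‖ ≤ C * dist ((Φ Δt)^[⌊t / Δt⌋₊] y₀) yg := by
    intro y₀ hy₀ t ht
    set n := ⌊t / Δt⌋₊
    have hn : n * Δt ≤ t := (le_div_iff₀ hΔt).1 (Nat.floor_le (by positivity))
    have hn' : t < (n + 1) * Δt := (div_lt_iff₀ hΔt).1 (Nat.lt_floor_add_one _)
    have hr : t - n * Δt ∈ Icc 0 Δt := ⟨by linarith, by linarith⟩
    have h := hCle _ hr _ (hmaps.iterate n hy₀) yg hyg
    rwa [heq _ hr.1, ← hiter y₀ hy₀, ← hΦflow _ (by positivity) _ hr.1 y₀ hy₀,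
      add_sub_cancel, dist_comm (Φ t y₀), dist_eq_norm yg, hiter y₀ hy₀] at h
  refine ⟨heq, fun ε hε => ⟨ε / C, by positivity, fun y₀ hy₀ hη t ht => ?_⟩, fun y₀ hy₀ => ?_⟩
  · have hle : ∀ n : ℕ, dist ((Φ Δt)^[n] y₀) yg ≤ dist y₀ yg := by
      intro n
      induction n with
      | zero => rfl
      | succ n ih =>
        rw [Function.iterate_succ_apply']
        by_cases h : (Φ Δt)^[n] y₀ = yg
        · simp [h, hper]
        · exact (hlt _ (hmaps.iterate n hy₀) h).le.trans ih
    rw [← dist_eq_norm, dist_comm, lt_div_iff₀' hC] at hη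
    exact (hbound y₀ hy₀ t ht).trans_lt ((mul_le_mul_of_nonneg_left (hle _) hC.le).trans_lt hη)
  · have hPcont : ContinuousOn (Φ Δt) (closedBall yg D) :=
      (LipschitzOnWith.of_dist_le_mul (K := ⟨C, hC.le⟩)
        (hCle Δt ⟨hΔt.le, le_rfl⟩)).continuousOn
    have hlim := (tendsto_dist_iterate_zero_of_dist_lt (isCompact_closedBall yg D) hPcont hmaps
      hlt (by rw [hper, dist_self]) hy₀).comp
      (tendsto_nat_floor_atTop.comp (tendsto_id.atTop_div_const hΔt))
    have hlim' := hlim.const_mul C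
    rw [mul_zero] at hlim'
    refine squeeze_zero' (Eventually.of_forall fun _ => norm_nonneg _) ?_ hlim'
    filter_upwards [eventually_ge_atTop 0] with t ht using hbound y₀ hy₀ t ht
end

section
/- If the surrogate stability conditions hold, then β is a class-𝒦𝓛 function on [0, D] × ℝ≥0 and δ(y₀, t) ≤ β(‖y_g − y₀‖, t) for every y₀ ∈ 𝓛 and every t ≥ 0. -/
open Metric Set Filter Topology

noncomputable def deltaMaxW {m : ℕ} (yg : EuclideanSpace ℝ (Fin m))
    (Φ : ℝ → EuclideanSpace ℝ (Fin m) → EuclideanSpace ℝ (Fin m))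
    (Δt : ℝ) (y₀ : EuclideanSpace ℝ (Fin m)) (t : ℝ) : ℝ :=
  sSup ((fun s => deltaFn yg Φ y₀ s) '' Set.Icc t (t + Δt))

noncomputable def deltaMax {m : ℕ} (yg : EuclideanSpace ℝ (Fin m))
    (Φ : ℝ → EuclideanSpace ℝ (Fin m) → EuclideanSpace ℝ (Fin m))
    (Δt : ℝ) (d₀ t : ℝ) : ℝ :=
  sSup ((fun y₀ => deltaMaxW yg Φ Δt y₀ t) '' Metric.sphere yg d₀)

noncomputable def betaFn {m : ℕ} (yg : EuclideanSpace ℝ (Fin m))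
    (Φ : ℝ → EuclideanSpace ℝ (Fin m) → EuclideanSpace ℝ (Fin m))
    (Δt α : ℝ) (d₀ t : ℝ) : ℝ :=
  Real.exp (α * t) * (deltaMax yg Φ Δt d₀ 0 + d₀)
    - α * ∫ s in (0:ℝ)..t, Real.exp (α * (t - s)) * deltaMax yg Φ Δt d₀ s

section ODE

variable {E : Type*} [NormedAddCommGroup E] [NormedSpace ℝ E]

theorem ContDiff.exists_lipschitzWith_eqOn_closedBall [FiniteDimensional ℝ E] {f : E → E}
    (hf : ContDiff ℝ 1 f) (c : E) {D : ℝ} (hD : 0 < D) :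
    ∃ (g : E → E) (K C : NNReal), LipschitzWith K g ∧ (∀ x, ‖g x‖ ≤ C) ∧
      EqOn g f (closedBall c D) := by
  let χ : ContDiffBump c := ⟨D, D + 1, hD, by linarith⟩
  have hχ : HasCompactSupport fun x => χ x • f x := χ.hasCompactSupport.smul_right
  have hdiff : ContDiff ℝ 1 fun x => χ x • f x := χ.contDiff.smul hf
  obtain ⟨K, hK⟩ := hdiff.lipschitzWith_of_hasCompactSupport hχ one_ne_zero
  obtain ⟨C, hC⟩ := hχ.exists_bound_of_continuous hdiff.continuous
  refine ⟨_, K, C.toNNReal, hK, fun x => (hC x).trans (Real.le_coe_toNNReal C), fun x hx => ?_⟩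
  simp [χ.one_of_mem_closedBall hx]

theorem LipschitzWith.exists_hasDerivWithinAt_Icc [CompleteSpace E] {g : E → E} {K C : NNReal}
    (hg : LipschitzWith K g) (hC : ∀ x, ‖g x‖ ≤ C) {T : ℝ} (hT : 0 ≤ T) (x₀ : E) :
    ∃ x : ℝ → E, x 0 = x₀ ∧ ∀ t ∈ Icc 0 T, HasDerivWithinAt x (g (x t)) (Icc 0 T) t := by
  have hpl : IsPicardLindelof (fun _ => g) (⟨0, left_mem_Icc.2 hT⟩ : Icc 0 T) x₀
      (C * T.toNNReal) 0 C K :=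
    .of_time_independent (fun x _ => hC x) hg.lipschitzOnWith (by simp [hT])
  exact hpl.exists_eq_forall_mem_Icc_hasDerivWithinAt₀

/-- `Φ` is the forward flow of the vector field `g` on the positively invariant set `s`. -/
structure IsForwardFlowOn (g : E → E) (Φ : ℝ → E → E) (s : Set E) : Prop where
  map_zero : ∀ y ∈ s, Φ 0 y = y
  mem : ∀ t, 0 ≤ t → ∀ y ∈ s, Φ t y ∈ s
  hasDerivAt : ∀ t, 0 ≤ t → ∀ y ∈ s, HasDerivAt (fun τ => Φ τ y) (g (Φ t y)) t
  map_add : ∀ r, 0 ≤ r → ∀ t, 0 ≤ t → ∀ y ∈ s, Φ (r + t) y = Φ t (Φ r y)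

namespace IsForwardFlowOn

variable {g : E → E} {Φ : ℝ → E → E} {s : Set E} {K C : NNReal}

theorem dist_le (h : IsForwardFlowOn g Φ s) (hg : LipschitzWith K g) {t : ℝ} (ht : 0 ≤ t)
    {y y' : E} (hy : y ∈ s) (hy' : y' ∈ s) :
    dist (Φ t y) (Φ t y') ≤ dist y y' * Real.exp (K * t) := by
  have := dist_le_of_trajectories_ODE_of_mem (v := fun _ => g) (s := fun _ => univ) (K := K)
    (a := 0) (b := t) (δ := dist y y') (f := fun τ => Φ τ y) (g := fun τ => Φ τ y')
    (fun _ _ => hg.lipschitzOnWith)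
    (fun τ hτ => (h.hasDerivAt τ hτ.1 y hy).continuousAt.continuousWithinAt)
    (fun τ hτ => (h.hasDerivAt τ hτ.1 y hy).hasDerivWithinAt) (fun _ _ => mem_univ _)
    (fun τ hτ => (h.hasDerivAt τ hτ.1 y' hy').continuousAt.continuousWithinAt)
    (fun τ hτ => (h.hasDerivAt τ hτ.1 y' hy').hasDerivWithinAt) (fun _ _ => mem_univ _)
    (by rw [h.map_zero y hy, h.map_zero y' hy']) t (right_mem_Icc.2 ht)
  simpa using this

theorem continuousOn (h : IsForwardFlowOn g Φ s) (hg : LipschitzWith K g)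
    (hC : ∀ x, ‖g x‖ ≤ C) : ContinuousOn (fun p : ℝ × E => Φ p.1 p.2) (Ici 0 ×ˢ s) := by
  refine continuousOn_prod_of_continuousOn_lipschitzOnWith _ C (fun t ht => ?_) fun y hy => ?_
  · refine (LipschitzOnWith.of_dist_le_mul (K := (Real.exp (K * t)).toNNReal)
      fun y hy y' hy' => ?_).continuousOn
    rw [Real.coe_toNNReal _ (Real.exp_pos _).le, mul_comm]
    exact h.dist_le hg ht hy hy'
  · exact (convex_Ici (0:ℝ)).lipschitzOnWith_of_nnnorm_hasDerivWithin_le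
      (fun t ht => (h.hasDerivAt t ht y hy).hasDerivWithinAt) fun t _ => hC _

theorem map_eq_of_hasDerivWithinAt_neg (h : IsForwardFlowOn g Φ s) (hg : LipschitzWith K g)
    {T : ℝ} (hT : 0 ≤ T) {x : ℝ → E}
    (hx : ∀ t ∈ Icc 0 T, HasDerivWithinAt x (-g (x t)) (Icc 0 T) t) (hxT : x T ∈ s) :
    Φ T (x T) = x 0 := by
  have hrev : ∀ t ∈ Icc 0 T,
      HasDerivWithinAt (fun τ => x (T - τ)) (g (x (T - t))) (Icc 0 T) t := by
    intro t ht
    have hmaps : MapsTo (fun τ => T - τ) (Icc 0 T) (Icc 0 T) := fun τ hτ =>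
      ⟨by linarith [hτ.2], by linarith [hτ.1]⟩
    have := (hx (T - t) (hmaps ht)).scomp t
      (((hasDerivAt_id t).const_sub T).hasDerivWithinAt) hmaps
    simpa [Function.comp_def] using this
  have := ODE_solution_unique_of_mem_Icc_right (v := fun _ => g) (s := fun _ => univ) (K := K)
    (a := 0) (b := T) (f := fun τ => Φ τ (x T)) (g := fun τ => x (T - τ))
    (fun _ _ => hg.lipschitzOnWith)
    (fun τ hτ => (h.hasDerivAt τ hτ.1 _ hxT).continuousAt.continuousWithinAt)
    (fun τ hτ => (h.hasDerivAt τ hτ.1 _ hxT).hasDerivWithinAt) (fun _ _ => mem_univ _)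
    (fun τ hτ => (hrev τ hτ).continuousWithinAt)
    (fun τ hτ => (hrev τ (Ico_subset_Icc_self hτ)).mono_of_mem_nhdsWithin
      (Icc_mem_nhdsGE_of_mem hτ)) (fun _ _ => mem_univ _)
    (by simp [h.map_zero _ hxT])
  simpa using this (right_mem_Icc.2 hT)

end IsForwardFlowOn

end ODE

section PeriodicDecrease

variable {E : Type*} [NormedAddCommGroup E] {Φ : ℝ → E → E} {c y : E} {Δ : ℝ}

theorem norm_sub_add_nat_mul_le
    (hdec : ∀ t, 0 ≤ t → ‖c - Φ (t + Δ) y‖ ≤ ‖c - Φ t y‖) (hΔ : 0 ≤ Δ) {t : ℝ} (ht : 0 ≤ t)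
    (n : ℕ) : ‖c - Φ (t + n * Δ) y‖ ≤ ‖c - Φ t y‖ := by
  induction n with
  | zero => simp
  | succ n ih =>
    have := hdec (t + n * Δ) (by positivity)
    rw [show t + ((n + 1 : ℕ) : ℝ) * Δ = t + n * Δ + Δ by push_cast; ring]
    exact this.trans ih

theorem exists_eq_add_nat_mul (hΔ : 0 < Δ) {t : ℝ} (ht : 0 ≤ t) :
    ∃ n : ℕ, ∃ s ∈ Ico 0 Δ, t = s + n * Δ := by
  have h1 := Nat.floor_le (div_nonneg ht hΔ.le)
  have h2 := Nat.lt_floor_add_one (t / Δ)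
  rw [le_div_iff₀ hΔ] at h1
  rw [div_lt_iff₀ hΔ] at h2
  exact ⟨⌊t / Δ⌋₊, t - ⌊t / Δ⌋₊ * Δ, ⟨by linarith, by linarith⟩, by ring⟩

theorem exists_mem_Icc_norm_sub_le
    (hdec : ∀ t, 0 ≤ t → ‖c - Φ (t + Δ) y‖ ≤ ‖c - Φ t y‖) (hΔ : 0 < Δ) {t τ : ℝ}
    (ht : 0 ≤ t) (hτ : t ≤ τ) : ∃ s ∈ Icc t (t + Δ), ‖c - Φ τ y‖ ≤ ‖c - Φ s y‖ := by
  obtain ⟨n, s, hs, hst⟩ := exists_eq_add_nat_mul hΔ (sub_nonneg.2 hτ)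
  refine ⟨t + s, ⟨by linarith [hs.1], by linarith [hs.2]⟩, ?_⟩
  have := norm_sub_add_nat_mul_le hdec hΔ.le (add_nonneg ht hs.1) n
  rwa [show t + s + n * Δ = τ by linarith] at this

end PeriodicDecrease

namespace IsForwardFlowOn

variable {E : Type*} [NormedAddCommGroup E] [NormedSpace ℝ E]
  {g : E → E} {Φ : ℝ → E → E} {K C : NNReal} {c : E} {D Δ : ℝ}

/-- A center that returns to itself after time `Δ` is an equilibrium. -/
theorem map_center (h : IsForwardFlowOn g Φ (closedBall c D)) (hD : 0 ≤ D) (hΔ : 0 ≤ Δ)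
    (hper : Φ Δ c = c) (hstrict : ∀ y ∈ closedBall c D, y ≠ c → ‖c - Φ Δ y‖ < ‖c - y‖)
    {t : ℝ} (ht : 0 ≤ t) : Φ t c = c := by
  by_contra hne
  have hc : c ∈ closedBall c D := mem_closedBall_self hD
  have hlt := hstrict _ (h.mem t ht c hc) hne
  rw [← h.map_add t ht Δ hΔ c hc, add_comm, h.map_add Δ hΔ t ht c hc, hper] at hlt
  exact lt_irrefl _ hlt

theorem exists_forall_norm_sub_lt [FiniteDimensional ℝ E]
    (h : IsForwardFlowOn g Φ (closedBall c D)) (hg : LipschitzWith K g) (hC : ∀ x, ‖g x‖ ≤ C)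
    (hΔ : 0 < Δ)
    (hdec : ∀ y ∈ closedBall c D, ∀ t, 0 ≤ t → ‖c - Φ (t + Δ) y‖ ≤ ‖c - Φ t y‖)
    (hstrict : ∀ y ∈ closedBall c D, y ≠ c → ‖c - Φ Δ y‖ < ‖c - y‖) {ε : ℝ} (hε : 0 < ε) :
    ∃ T, 0 ≤ T ∧ ∀ y ∈ closedBall c D, ∀ t, T ≤ t → ‖c - Φ t y‖ < ε := by
  have hcompact : IsCompact (closedBall c D ∩ {y | ε ≤ ‖c - y‖}) :=
    (isCompact_closedBall c D).inter_right (isClosed_le (by fun_prop) (by fun_prop))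
  have hcont : ContinuousOn (fun y => ‖c - y‖ - ‖c - Φ Δ y‖)
      (closedBall c D ∩ {y | ε ≤ ‖c - y‖}) := by
    have : ContinuousOn (fun y => Φ Δ y) (closedBall c D ∩ {y | ε ≤ ‖c - y‖}) :=
      (h.continuousOn hg hC).comp (f := fun y : E => (Δ, y)) (by fun_prop)
        fun y hy => ⟨hΔ.le, hy.1⟩
    fun_prop
  obtain ⟨η, hη, hηle⟩ : ∃ η > 0, ∀ y ∈ closedBall c D, ε ≤ ‖c - y‖ →
      η ≤ ‖c - y‖ - ‖c - Φ Δ y‖ := by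
    rcases (closedBall c D ∩ {y | ε ≤ ‖c - y‖}).eq_empty_or_nonempty with hemp | hne
    · refine ⟨1, one_pos, fun y hy hy' => ?_⟩
      exact absurd (show y ∈ closedBall c D ∩ {y | ε ≤ ‖c - y‖} from ⟨hy, hy'⟩) (by simp [hemp])
    · obtain ⟨y, hy, hmin⟩ := hcompact.exists_isMinOn hne hcont
      refine ⟨_, sub_pos.2 (hstrict y hy.1 ?_), fun z hz hz' => hmin ⟨hz, hz'⟩⟩
      rintro rfl
      have : ε ≤ ‖y - y‖ := hy.2
      simp at this
      linarith
  have hiter : ∀ n : ℕ, ∀ y ∈ closedBall c D, ε ≤ ‖c - Φ (n * Δ) y‖ →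
      ‖c - Φ (n * Δ) y‖ ≤ D - n * η := by
    intro n y hy
    have hnorm : ∀ z ∈ closedBall c D, ‖c - z‖ ≤ D := fun z hz => by
      rwa [mem_closedBall, dist_comm, dist_eq_norm] at hz
    induction n with
    | zero => intro _; simpa [h.map_zero y hy] using hnorm y hy
    | succ n ih =>
      intro hle
      have hn : (0:ℝ) ≤ n * Δ := by positivity
      have hstep := hdec y hy (n * Δ) hn
      rw [show ((n + 1 : ℕ) : ℝ) * Δ = n * Δ + Δ by push_cast; ring] at hle ⊢
      have := hηle _ (h.mem _ hn y hy) (hle.trans hstep)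
      rw [← h.map_add _ hn Δ hΔ.le y hy] at this
      push_cast
      linarith [ih (hle.trans hstep)]
  obtain ⟨n, hn⟩ := exists_nat_gt (D / η)
  rw [div_lt_iff₀ hη] at hn
  refine ⟨n * Δ, by positivity, fun y hy t ht => ?_⟩
  have hnΔ : (0:ℝ) ≤ n * Δ := by positivity
  have hs : 0 ≤ t - n * Δ := sub_nonneg.2 ht
  rw [show t = (t - n * Δ) + n * Δ by ring, h.map_add _ hs _ hnΔ y hy]
  by_contra! hcon
  have := hiter n _ (h.mem _ hs y hy) hcon
  linarith

/-- Backward continuation: every point other than the center is reached from every larger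
sphere. -/
theorem exists_mem_sphere_map_eq [FiniteDimensional ℝ E]
    (h : IsForwardFlowOn g Φ (closedBall c D)) (hg : LipschitzWith K g) (hC : ∀ x, ‖g x‖ ≤ C)
    (hΔ : 0 < Δ)
    (hdec : ∀ y ∈ closedBall c D, ∀ t, 0 ≤ t → ‖c - Φ (t + Δ) y‖ ≤ ‖c - Φ t y‖)
    (hstrict : ∀ y ∈ closedBall c D, y ≠ c → ‖c - Φ Δ y‖ < ‖c - y‖)
    {y : E} {r : ℝ} (hy : y ≠ c) (hyr : ‖c - y‖ ≤ r) (hrD : r ≤ D) :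
    ∃ T, 0 ≤ T ∧ ∃ z ∈ sphere c r, Φ T z = y := by
  obtain ⟨T, hT, hTlt⟩ := h.exists_forall_norm_sub_lt hg hC hΔ hdec hstrict
    (norm_pos_iff.2 (sub_ne_zero.2 hy.symm))
  have hg' : LipschitzWith K fun x => -g x := LipschitzWith.of_dist_le_mul fun a b => by
    rw [dist_neg_neg]
    exact hg.dist_le_mul a b
  obtain ⟨x, hx0, hx⟩ := hg'.exists_hasDerivWithinAt_Icc (C := C)
    (fun x => by rw [norm_neg]; exact hC x) hT y
  have hxc : ContinuousOn (fun t => ‖c - x t‖) (Icc 0 T) :=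
    (continuousOn_const.sub fun t ht => (hx t ht).continuousWithinAt).norm
  have hback : ∀ t ∈ Icc 0 T, x t ∈ closedBall c D → Φ t (x t) = y := fun t ht hxt => by
    rw [← hx0]
    exact h.map_eq_of_hasDerivWithinAt_neg hg ht.1 (fun τ hτ =>
      (hx τ ⟨hτ.1, hτ.2.trans ht.2⟩).mono (Icc_subset_Icc_right ht.2)) hxt
  obtain ⟨t, ht, htr⟩ : ∃ t ∈ Icc 0 T, ‖c - x t‖ = r := by
    refine intermediate_value_Icc hT hxc ⟨by rwa [hx0], ?_⟩
    by_contra! hlt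
    have hxT : x T ∈ closedBall c D := by
      rw [mem_closedBall, dist_comm, dist_eq_norm]
      exact hlt.le.trans hrD
    have := hTlt _ hxT T le_rfl
    rw [hback T (right_mem_Icc.2 hT) hxT] at this
    exact lt_irrefl _ this
  have hxt : x t ∈ sphere c r := by rw [mem_sphere, dist_comm, dist_eq_norm, htr]
  exact ⟨t, ht.1, x t, hxt, hback t ht (closedBall_subset_closedBall hrD
    (sphere_subset_closedBall hxt))⟩

end IsForwardFlowOn

/-- The solution of `z' = α (z - u)` with `z 0 = z₀`, given by variation of constants. -/
noncomputable def lowPass (α z₀ : ℝ) (u : ℝ → ℝ) (t : ℝ) : ℝ :=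
  Real.exp (α * t) * z₀ - α * ∫ s in (0:ℝ)..t, Real.exp (α * (t - s)) * u s

section LowPass

variable {α z₀ z₁ : ℝ} {u v : ℝ → ℝ} {t : ℝ}

theorem lowPass_zero : lowPass α z₀ u 0 = z₀ := by
  simp [lowPass]

theorem lowPass_congr (ht : 0 ≤ t) (h : ∀ s ∈ Icc 0 t, u s = v s) :
    lowPass α z₀ u t = lowPass α z₀ v t := by
  unfold lowPass
  congr 2
  refine intervalIntegral.integral_congr fun s hs => ?_
  rw [uIcc_of_le ht] at hs
  simp only [h s hs]

theorem lowPass_lt_lowPass (hα : α ≤ 0) (hu : Continuous u) (hv : Continuous v) (ht : 0 ≤ t)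
    (hz : z₀ < z₁) (h : ∀ s ∈ Icc 0 t, u s ≤ v s) :
    lowPass α z₀ u t < lowPass α z₁ v t := by
  have hint : ∫ s in (0:ℝ)..t, Real.exp (α * (t - s)) * u s ≤
      ∫ s in (0:ℝ)..t, Real.exp (α * (t - s)) * v s := by
    refine intervalIntegral.integral_mono_on ht
      (Continuous.intervalIntegrable (by fun_prop) _ _)
      (Continuous.intervalIntegrable (by fun_prop) _ _) fun s hs => ?_
    exact mul_le_mul_of_nonneg_left (h s hs) (Real.exp_pos _).le
  have h1 := mul_lt_mul_of_pos_left hz (Real.exp_pos (α * t))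
  have h2 := mul_le_mul_of_nonpos_left hint hα
  unfold lowPass
  linarith

theorem hasDerivAt_lowPass (hu : Continuous u) (t : ℝ) :
    HasDerivAt (lowPass α z₀ u) (α * (lowPass α z₀ u t - u t)) t := by
  have hfac : ∀ r, lowPass α z₀ u r =
      Real.exp (α * r) * (z₀ - α * ∫ s in (0:ℝ)..r, Real.exp (-(α * s)) * u s) := by
    intro r
    have : ∫ s in (0:ℝ)..r, Real.exp (α * (r - s)) * u s =
        Real.exp (α * r) * ∫ s in (0:ℝ)..r, Real.exp (-(α * s)) * u s := by
      rw [← intervalIntegral.integral_const_mul]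
      congr 1
      funext s
      rw [← mul_assoc, ← Real.exp_add]
      ring_nf
    rw [lowPass, this]
    ring
  have hexp : HasDerivAt (fun r => Real.exp (α * r)) (Real.exp (α * t) * α) t := by
    simpa using ((hasDerivAt_id t).const_mul α).exp
  have hcont : Continuous fun s => Real.exp (-(α * s)) * u s := by fun_prop
  have hint : HasDerivAt (fun r => ∫ s in (0:ℝ)..r, Real.exp (-(α * s)) * u s)
      (Real.exp (-(α * t)) * u t) t := hcont.integral_hasStrictDerivAt 0 t |>.hasDerivAt
  have hprod := hexp.mul ((hint.const_mul α).const_sub z₀)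
  rw [funext hfac]
  refine hprod.congr_deriv ?_
  have hcancel : Real.exp (α * t) * Real.exp (-(α * t)) = 1 := by
    rw [← Real.exp_add, add_neg_cancel, Real.exp_zero]
  linear_combination (-(α * u t)) * hcancel

theorem hasDerivAt_exp_mul_lowPass_sub (hu : Continuous u) (c t : ℝ) :
    HasDerivAt (fun s => Real.exp (-(α * s)) * (lowPass α z₀ u s - c))
      (-α * Real.exp (-(α * t)) * (c - u t) * (-1)) t := by
  have hexp : HasDerivAt (fun r => Real.exp (-(α * r))) (Real.exp (-(α * t)) * -α) t := by
    simpa using ((hasDerivAt_id t).const_mul α).neg.exp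
  refine (hexp.mul ((hasDerivAt_lowPass hu t).sub_const c)).congr_deriv ?_
  ring

theorem le_lowPass (hα : α ≤ 0) (hu : Continuous u) (hanti : AntitoneOn u (Ici 0))
    (hz : u 0 ≤ z₀) (ht : 0 ≤ t) : u t ≤ lowPass α z₀ u t := by
  have hd := hasDerivAt_exp_mul_lowPass_sub (α := α) (z₀ := z₀) hu (u t)
  have hmono : MonotoneOn (fun s => Real.exp (-(α * s)) * (lowPass α z₀ u s - u t))
      (Icc 0 t) := by
    refine monotoneOn_of_deriv_nonneg (convex_Icc 0 t)
      (fun s _ => (hd s).continuousAt.continuousWithinAt)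
      (fun s _ => (hd s).differentiableAt.differentiableWithinAt) fun s hs => ?_
    rw [interior_Icc] at hs
    rw [(hd s).deriv]
    have h1 : u t ≤ u s := hanti hs.1.le ht hs.2.le
    have h2 : 0 ≤ -α * Real.exp (-(α * s)) := mul_nonneg (by linarith) (Real.exp_pos _).le
    nlinarith [mul_nonneg h2 (sub_nonneg.2 h1)]
  have h := hmono (left_mem_Icc.2 ht) (right_mem_Icc.2 ht) ht
  simp only [lowPass_zero, mul_zero, neg_zero, Real.exp_zero, one_mul] at h
  have h0 : u t ≤ u 0 := hanti (mem_Ici.2 le_rfl) ht ht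
  have : 0 ≤ Real.exp (-(α * t)) * (lowPass α z₀ u t - u t) := by linarith
  linarith [nonneg_of_mul_nonneg_right this (Real.exp_pos _)]

theorem antitoneOn_lowPass (hα : α ≤ 0) (hu : Continuous u) (hanti : AntitoneOn u (Ici 0))
    (hz : u 0 ≤ z₀) : AntitoneOn (lowPass α z₀ u) (Ici 0) := by
  refine antitoneOn_of_deriv_nonpos (convex_Ici 0)
    (fun s _ => (hasDerivAt_lowPass hu s).continuousAt.continuousWithinAt)
    (fun s _ => (hasDerivAt_lowPass hu s).differentiableAt.differentiableWithinAt) fun s hs => ?_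
  rw [interior_Ici] at hs
  rw [(hasDerivAt_lowPass hu s).deriv]
  exact mul_nonpos_of_nonpos_of_nonneg hα
    (sub_nonneg.2 (le_lowPass hα hu hanti hz (le_of_lt hs)))

theorem tendsto_lowPass (hα : α < 0) (hu : Continuous u) (hanti : AntitoneOn u (Ici 0))
    (hz : u 0 ≤ z₀) (hlim : Tendsto u atTop (𝓝 0)) :
    Tendsto (lowPass α z₀ u) atTop (𝓝 0) := by
  have hnonneg : ∀ t, 0 ≤ t → 0 ≤ u t := fun t ht =>
    le_of_tendsto hlim ((eventually_ge_atTop t).mono fun r hr => hanti ht (ht.trans hr) hr)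
  rw [Metric.tendsto_atTop]
  intro ε hε
  obtain ⟨N, hN⟩ := eventually_atTop.1 (hlim.eventually_lt_const (half_pos hε))
  have hd := hasDerivAt_exp_mul_lowPass_sub (α := α) (z₀ := z₀) hu (ε / 2)
  have hanti' : AntitoneOn (fun s => Real.exp (-(α * s)) * (lowPass α z₀ u s - ε / 2))
      (Ici N) := by
    refine antitoneOn_of_deriv_nonpos (convex_Ici N)
      (fun s _ => (hd s).continuousAt.continuousWithinAt)
      (fun s _ => (hd s).differentiableAt.differentiableWithinAt) fun s hs => ?_
    rw [interior_Ici] at hs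
    rw [(hd s).deriv]
    have h1 := hN s (le_of_lt hs)
    have h2 : 0 ≤ -α * Real.exp (-(α * s)) := mul_nonneg (by linarith) (Real.exp_pos _).le
    nlinarith [mul_nonneg h2 (sub_nonneg.2 h1.le)]
  set M := Real.exp (-(α * N)) * (lowPass α z₀ u N - ε / 2) with hM
  have hdecay : Tendsto (fun s => Real.exp (α * s) * M) atTop (𝓝 0) := by
    simpa using (Real.tendsto_exp_atBot.comp
      (tendsto_id.const_mul_atTop_of_neg hα)).mul_const M
  obtain ⟨N', hN'⟩ := eventually_atTop.1 (hdecay.eventually_lt_const (half_pos hε))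
  refine ⟨max (max N N') 0, fun s hs => ?_⟩
  have hsN : N ≤ s := (le_max_left _ _).trans ((le_max_left _ _).trans hs)
  have hsN' : N' ≤ s := (le_max_right _ _).trans ((le_max_left _ _).trans hs)
  have hs0 : 0 ≤ s := (le_max_right _ _).trans hs
  have h0 := (hnonneg s hs0).trans (le_lowPass hα.le hu hanti hz hs0)
  rw [Real.dist_eq, sub_zero, abs_of_nonneg h0]
  have h1 := mul_le_mul_of_nonneg_left (hanti' (mem_Ici.2 le_rfl) hsN hsN)
    (Real.exp_pos (α * s)).le
  simp only [← hM] at h1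
  rw [← mul_assoc, ← Real.exp_add, add_neg_cancel, Real.exp_zero, one_mul] at h1
  linarith [hN' s hsN']

theorem continuous_lowPass {z : ℝ → ℝ} {w : ℝ → ℝ → ℝ} (hz : Continuous z)
    (hw : Continuous (Function.uncurry w)) :
    Continuous fun p : ℝ × ℝ => lowPass α (z p.1) (w p.1) p.2 := by
  unfold lowPass
  have : Continuous fun p : ℝ × ℝ => ∫ s in (0:ℝ)..p.2, Real.exp (α * (p.2 - s)) * w p.1 s := by
    refine intervalIntegral.continuous_parametric_intervalIntegral_of_continuous
      (f := fun (p : ℝ × ℝ) s => Real.exp (α * (p.2 - s)) * w p.1 s) ?_ continuous_snd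
    have : Continuous fun q : (ℝ × ℝ) × ℝ => w q.1.1 q.2 :=
      hw.comp ((continuous_fst.comp continuous_fst).prodMk continuous_snd)
    simp only [Function.uncurry_def]
    fun_prop
  fun_prop

end LowPass

section DeltaMax

variable {m : ℕ} {yg : EuclideanSpace ℝ (Fin m)} {D Δt : ℝ}
  {Φ : ℝ → EuclideanSpace ℝ (Fin m) → EuclideanSpace ℝ (Fin m)}
  {g : EuclideanSpace ℝ (Fin m) → EuclideanSpace ℝ (Fin m)} {K C : NNReal}

theorem deltaFn_le_deltaMax (h : IsForwardFlowOn g Φ (closedBall yg D)) {d t s : ℝ} (hd : d ≤ D)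
    (ht : 0 ≤ t) {y : EuclideanSpace ℝ (Fin m)} (hy : y ∈ sphere yg d)
    (hs : s ∈ Icc t (t + Δt)) : deltaFn yg Φ y s ≤ deltaMax yg Φ Δt d t := by
  have hbound : ∀ z ∈ sphere yg d, ∀ r ∈ Icc t (t + Δt), deltaFn yg Φ z r ≤ D := by
    intro z hz r hr
    have := h.mem r (ht.trans hr.1) z
      (closedBall_subset_closedBall hd (sphere_subset_closedBall hz))
    rwa [mem_closedBall, dist_comm, dist_eq_norm] at this
  have h1 : deltaFn yg Φ y s ≤ deltaMaxW yg Φ Δt y t :=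
    le_csSup ⟨D, by rintro _ ⟨r, hr, rfl⟩; exact hbound y hy r hr⟩ (mem_image_of_mem _ hs)
  refine h1.trans (le_csSup ⟨D, ?_⟩ (mem_image_of_mem _ hy))
  rintro _ ⟨z, hz, rfl⟩
  refine csSup_le ((nonempty_Icc.2 (hs.1.trans hs.2)).image _) ?_
  rintro _ ⟨r, hr, rfl⟩
  exact hbound z hz r hr

theorem deltaMax_le (hm : 1 ≤ m) (hΔt : 0 ≤ Δt) {d t b : ℝ} (hd : 0 ≤ d)
    (hb : ∀ y ∈ sphere yg d, ∀ s ∈ Icc t (t + Δt), deltaFn yg Φ y s ≤ b) :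
    deltaMax yg Φ Δt d t ≤ b := by
  have : Nonempty (Fin m) := ⟨⟨0, hm⟩⟩
  refine csSup_le ((NormedSpace.sphere_nonempty.2 hd).image _) ?_
  rintro _ ⟨y, hy, rfl⟩
  refine csSup_le ((nonempty_Icc.2 (by linarith)).image _) ?_
  rintro _ ⟨s, hs, rfl⟩
  exact hb y hy s hs

theorem deltaMax_nonneg (d t : ℝ) : 0 ≤ deltaMax yg Φ Δt d t := by
  refine Real.sSup_nonneg ?_
  rintro _ ⟨y, -, rfl⟩
  refine Real.sSup_nonneg ?_
  rintro _ ⟨s, -, rfl⟩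
  exact norm_nonneg _

theorem continuousOn_deltaMax (hm : 1 ≤ m) (h : IsForwardFlowOn g Φ (closedBall yg D))
    (hg : LipschitzWith K g) (hC : ∀ x, ‖g x‖ ≤ C) (hΔt : 0 ≤ Δt) :
    ContinuousOn (fun p : ℝ × ℝ => deltaMax yg Φ Δt p.1 p.2) (Icc 0 D ×ˢ Ici 0) := by
  have : Nonempty (Fin m) := ⟨⟨0, hm⟩⟩
  let F : ↥(Icc 0 D ×ˢ Ici (0:ℝ)) →
      sphere (0 : EuclideanSpace ℝ (Fin m)) 1 × Icc 0 Δt → ℝ := fun p q =>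
    ‖yg - Φ (p.1.2 + q.2) (yg + p.1.1 • (q.1 : EuclideanSpace ℝ (Fin m)))‖
  have hsphere : ∀ d, 0 ≤ d → ∀ u ∈ sphere (0 : EuclideanSpace ℝ (Fin m)) 1,
      yg + d • u ∈ sphere yg d := by
    intro d hd u hu
    rw [mem_sphere_zero_iff_norm] at hu
    simp [norm_smul, hu, abs_of_nonneg hd]
  have hF : Continuous (Function.uncurry F) := by
    refine continuous_const.sub ?_ |>.norm
    refine (h.continuousOn hg hC).comp_continuous
      (f := fun x : ↥(Icc 0 D ×ˢ Ici (0:ℝ)) ×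
          (sphere (0 : EuclideanSpace ℝ (Fin m)) 1 × Icc 0 Δt) =>
        (x.1.1.2 + (x.2.2 : ℝ), yg + x.1.1.1 • (x.2.1 : EuclideanSpace ℝ (Fin m))))
      (by fun_prop) fun x => ⟨?_, ?_⟩
    · exact add_nonneg x.1.2.2 x.2.2.2.1
    · exact closedBall_subset_closedBall x.1.2.1.2
        (sphere_subset_closedBall (hsphere _ x.1.2.1.1 _ x.2.1.2))
  rw [continuousOn_iff_continuous_domRestrict]
  refine (isCompact_univ.continuous_sSup (f := F) hF).congr fun p => ?_
  obtain ⟨⟨d, t⟩, ⟨hd, hdD⟩, ht⟩ := p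
  have hmem : ∀ q, F ⟨(d, t), ⟨hd, hdD⟩, ht⟩ q ≤ deltaMax yg Φ Δt d t := fun q =>
    deltaFn_le_deltaMax h hdD ht (hsphere d hd q.1 q.1.2)
      ⟨by linarith [q.2.2.1], by linarith [q.2.2.2]⟩
  have hnonempty : Nonempty (sphere (0 : EuclideanSpace ℝ (Fin m)) 1 × Icc 0 Δt) := by
    obtain ⟨u, hu⟩ := NormedSpace.sphere_nonempty (E := EuclideanSpace ℝ (Fin m))
      (x := 0) (r := 1) |>.2 zero_le_one
    exact ⟨⟨u, hu⟩, ⟨0, left_mem_Icc.2 hΔt⟩⟩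
  refine le_antisymm (csSup_le (univ_nonempty.image _) ?_) (deltaMax_le hm hΔt hd ?_)
  · rintro _ ⟨q, -, rfl⟩
    exact hmem q
  · intro y hy s hs
    obtain ⟨u, hu, rfl⟩ : ∃ u ∈ sphere (0 : EuclideanSpace ℝ (Fin m)) 1, y = yg + d • u := by
      rw [mem_sphere, dist_eq_norm] at hy
      rcases hd.eq_or_lt with rfl | hd
      · obtain ⟨⟨u, -⟩⟩ := hnonempty
        refine ⟨u, u.2, ?_⟩
        rw [zero_smul, add_zero]
        exact sub_eq_zero.1 (norm_eq_zero.1 hy)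
      · refine ⟨d⁻¹ • (y - yg), ?_, ?_⟩
        · rw [mem_sphere_zero_iff_norm, norm_smul, hy, Real.norm_of_nonneg (inv_nonneg.2 hd.le),
            inv_mul_cancel₀ hd.ne']
        · rw [smul_inv_smul₀ hd.ne', add_sub_cancel]
    refine le_csSup ⟨deltaMax yg Φ Δt d t, ?_⟩
      ⟨(⟨u, hu⟩, ⟨s - t, by linarith [hs.1], by linarith [hs.2]⟩), mem_univ _, ?_⟩
    · rintro _ ⟨q, -, rfl⟩
      exact hmem q
    · simp [F, deltaFn]

theorem antitoneOn_deltaMax (hm : 1 ≤ m) (h : IsForwardFlowOn g Φ (closedBall yg D))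
    (hΔt : 0 < Δt)
    (hdec : ∀ y ∈ closedBall yg D, ∀ t, 0 ≤ t → ‖yg - Φ (t + Δt) y‖ ≤ ‖yg - Φ t y‖)
    {d : ℝ} (hd : d ∈ Icc 0 D) : AntitoneOn (deltaMax yg Φ Δt d) (Ici 0) := by
  intro t ht t' _ htt'
  refine deltaMax_le hm hΔt.le hd.1 fun y hy s hs => ?_
  obtain ⟨r, hr, hle⟩ := exists_mem_Icc_norm_sub_le
    (hdec y (closedBall_subset_closedBall hd.2 (sphere_subset_closedBall hy))) hΔt ht
    (htt'.trans hs.1)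
  exact hle.trans (deltaFn_le_deltaMax h hd.2 ht hy hr)

theorem tendsto_deltaMax (hm : 1 ≤ m) (h : IsForwardFlowOn g Φ (closedBall yg D))
    (hg : LipschitzWith K g) (hC : ∀ x, ‖g x‖ ≤ C) (hΔt : 0 < Δt)
    (hdec : ∀ y ∈ closedBall yg D, ∀ t, 0 ≤ t → ‖yg - Φ (t + Δt) y‖ ≤ ‖yg - Φ t y‖)
    (hstrict : ∀ y ∈ closedBall yg D, y ≠ yg → ‖yg - Φ Δt y‖ < ‖yg - y‖)
    {d : ℝ} (hd : d ∈ Icc 0 D) : Tendsto (deltaMax yg Φ Δt d) atTop (𝓝 0) := by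
  rw [Metric.tendsto_atTop]
  intro ε hε
  obtain ⟨T, -, hT⟩ := h.exists_forall_norm_sub_lt hg hC hΔt hdec hstrict (half_pos hε)
  refine ⟨T, fun t ht => ?_⟩
  rw [Real.dist_eq, sub_zero, abs_of_nonneg (deltaMax_nonneg d t)]
  refine lt_of_le_of_lt (deltaMax_le hm hΔt.le hd.1 fun y hy s hs => ?_) (half_lt_self hε)
  exact (hT y (closedBall_subset_closedBall hd.2 (sphere_subset_closedBall hy)) s
    (ht.trans hs.1)).le

theorem monotoneOn_deltaMax (hm : 1 ≤ m) (h : IsForwardFlowOn g Φ (closedBall yg D))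
    (hg : LipschitzWith K g) (hC : ∀ x, ‖g x‖ ≤ C) (hΔt : 0 < Δt)
    (hdec : ∀ y ∈ closedBall yg D, ∀ t, 0 ≤ t → ‖yg - Φ (t + Δt) y‖ ≤ ‖yg - Φ t y‖)
    (hstrict : ∀ y ∈ closedBall yg D, y ≠ yg → ‖yg - Φ Δt y‖ < ‖yg - y‖)
    (hfix : ∀ t, 0 ≤ t → Φ t yg = yg) {t : ℝ} (ht : 0 ≤ t) :
    MonotoneOn (fun d => deltaMax yg Φ Δt d t) (Icc 0 D) := by
  intro d hd r hr hdr
  refine deltaMax_le hm hΔt.le hd.1 fun y hy s hs => ?_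
  have hs0 : 0 ≤ s := ht.trans hs.1
  by_cases hyg : y = yg
  · rw [deltaFn, hyg, hfix s hs0, sub_self, norm_zero]
    exact deltaMax_nonneg r t
  have hyr : ‖yg - y‖ ≤ r := by
    rw [mem_sphere, dist_comm, dist_eq_norm] at hy
    rwa [hy]
  obtain ⟨T, hT, z, hz, rfl⟩ :=
    h.exists_mem_sphere_map_eq hg hC hΔt hdec hstrict hyg hyr hr.2
  have hzD := closedBall_subset_closedBall hr.2 (sphere_subset_closedBall hz)
  obtain ⟨σ, hσ, hle⟩ := exists_mem_Icc_norm_sub_le (hdec z hzD) hΔt ht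
    (show t ≤ T + s by linarith [hs.1])
  rw [h.map_add T hT s hs0 z hzD] at hle
  exact hle.trans (deltaFn_le_deltaMax h hr.2 ht hz hσ)

theorem deltaMax_zero (hm : 1 ≤ m) (hΔt : 0 ≤ Δt) (hfix : ∀ t, 0 ≤ t → Φ t yg = yg)
    {t : ℝ} (ht : 0 ≤ t) : deltaMax yg Φ Δt 0 t = 0 := by
  refine le_antisymm (deltaMax_le hm hΔt le_rfl fun y hy s hs => ?_) (deltaMax_nonneg 0 t)
  rw [sphere_zero, mem_singleton_iff] at hy
  rw [hy, deltaFn, hfix s (ht.trans hs.1), sub_self, norm_zero]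

theorem betaFn_eq_lowPass (α d t : ℝ) :
    betaFn yg Φ Δt α d t =
      lowPass α (deltaMax yg Φ Δt d 0 + d) (deltaMax yg Φ Δt d) t := rfl

end DeltaMax

theorem stmt_4
    (m : ℕ) (hm : 1 ≤ m)
    (yg : EuclideanSpace ℝ (Fin m)) (D : ℝ) (hD : 0 < D)
    (f : EuclideanSpace ℝ (Fin m) → EuclideanSpace ℝ (Fin m))
    (hf : ContDiff ℝ 1 f)
    (Φ : ℝ → EuclideanSpace ℝ (Fin m) → EuclideanSpace ℝ (Fin m))
    (hΦ0 : ∀ y₀ ∈ Metric.closedBall yg D, Φ 0 y₀ = y₀)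
    (hΦinv : ∀ t : ℝ, 0 ≤ t → ∀ y₀ ∈ Metric.closedBall yg D,
      Φ t y₀ ∈ Metric.closedBall yg D)
    (hΦderiv : ∀ t : ℝ, 0 ≤ t → ∀ y₀ ∈ Metric.closedBall yg D,
      HasDerivAt (fun τ => Φ τ y₀) (f (Φ t y₀)) t)
    (hΦflow : ∀ s : ℝ, 0 ≤ s → ∀ t : ℝ, 0 ≤ t → ∀ y₀ ∈ Metric.closedBall yg D,
      Φ (s + t) y₀ = Φ t (Φ s y₀))
    (Δt : ℝ) (hΔt : 0 < Δt) (α : ℝ) (hα : α < 0)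
    (hsur1 : ∀ t : ℝ, 0 ≤ t → deltaFn yg Φ yg (t + Δt) = deltaFn yg Φ yg t)
    (hsur2 : ∀ t : ℝ, 0 ≤ t → ∀ y₀ ∈ Metric.closedBall yg D, y₀ ≠ yg →
      deltaFn yg Φ y₀ (t + Δt) < deltaFn yg Φ y₀ t)
    :
    (ContinuousOn (fun p : ℝ × ℝ => betaFn yg Φ Δt α p.1 p.2)
      (Set.Icc 0 D ×ˢ Set.Ici 0)) ∧
    (∀ s : ℝ, 0 ≤ s → StrictMonoOn (fun r => betaFn yg Φ Δt α r s) (Set.Icc 0 D)) ∧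
    (∀ s : ℝ, 0 ≤ s → betaFn yg Φ Δt α 0 s = 0) ∧
    (∀ r ∈ Set.Icc (0:ℝ) D, AntitoneOn (fun s => betaFn yg Φ Δt α r s) (Set.Ici 0)) ∧
    (∀ r ∈ Set.Icc (0:ℝ) D,
      Filter.Tendsto (fun s => betaFn yg Φ Δt α r s) Filter.atTop (𝓝 0)) ∧
    (∀ y₀ ∈ Metric.closedBall yg D, ∀ t : ℝ, 0 ≤ t →
      deltaFn yg Φ y₀ t ≤ betaFn yg Φ Δt α ‖yg - y₀‖ t) := by
  obtain ⟨g, K, C, hg, hC, hgf⟩ := hf.exists_lipschitzWith_eqOn_closedBall yg hD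
  have h : IsForwardFlowOn g Φ (closedBall yg D) :=
    ⟨hΦ0, hΦinv, fun t ht y hy => by
      rw [hgf (hΦinv t ht y hy)]
      exact hΦderiv t ht y hy, hΦflow⟩
  have hyg : yg ∈ closedBall yg D := mem_closedBall_self hD.le
  have hdec : ∀ y ∈ closedBall yg D, ∀ t, 0 ≤ t → ‖yg - Φ (t + Δt) y‖ ≤ ‖yg - Φ t y‖ := by
    intro y hy t ht
    by_cases hne : y = yg
    · rw [hne]
      exact (hsur1 t ht).le
    · exact (hsur2 t ht y hy hne).le
  have hstrict : ∀ y ∈ closedBall yg D, y ≠ yg → ‖yg - Φ Δt y‖ < ‖yg - y‖ := by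
    intro y hy hne
    simpa [deltaFn, hΦ0 y hy] using hsur2 0 le_rfl y hy hne
  have hper : Φ Δt yg = yg := by
    have := hsur1 0 le_rfl
    simp only [deltaFn, zero_add, hΦ0 yg hyg, sub_self, norm_zero, norm_eq_zero] at this
    exact (sub_eq_zero.1 this).symm
  have hfix : ∀ t, 0 ≤ t → Φ t yg = yg := fun t ht =>
    h.map_center hD.le hΔt.le hper hstrict ht
  -- `deltaMax`, extended continuously from `[0, D] × [0, ∞)` to the plane
  let w : ℝ → ℝ → ℝ := fun d t => deltaMax yg Φ Δt (projIcc 0 D hD.le d) (max t 0)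
  have hw : Continuous (Function.uncurry w) :=
    (continuousOn_deltaMax hm h hg hC hΔt.le).comp_continuous
      (f := fun p : ℝ × ℝ => ((projIcc 0 D hD.le p.1 : ℝ), max p.2 0))
      (by fun_prop) fun p => ⟨(projIcc 0 D hD.le p.1).2, mem_Ici.2 (le_max_right p.2 0)⟩
  have hwd : ∀ d, Continuous (w d) := fun d => hw.comp (Continuous.prodMk_right d)
  have hweq : ∀ d ∈ Icc 0 D, ∀ t, 0 ≤ t → w d t = deltaMax yg Φ Δt d t := by
    intro d hd t ht
    simp only [w, projIcc_of_mem hD.le hd, max_eq_left ht]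
  have hβ : ∀ d ∈ Icc 0 D, ∀ t, 0 ≤ t →
      betaFn yg Φ Δt α d t = lowPass α (w d 0 + d) (w d) t := by
    intro d hd t ht
    rw [betaFn_eq_lowPass, hweq d hd 0 le_rfl]
    exact lowPass_congr ht fun s hs => (hweq d hd s hs.1).symm
  have hwanti : ∀ d ∈ Icc 0 D, AntitoneOn (w d) (Ici 0) := fun d hd =>
    (antitoneOn_deltaMax hm h hΔt hdec hd).congr fun t ht => (hweq d hd t ht).symm
  have hwlim : ∀ d ∈ Icc 0 D, Tendsto (w d) atTop (𝓝 0) := fun d hd =>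
    (tendsto_deltaMax hm h hg hC hΔt hdec hstrict hd).congr'
      ((eventually_ge_atTop 0).mono fun t ht => (hweq d hd t ht).symm)
  have hz : ∀ d ∈ Icc 0 D, w d 0 ≤ w d 0 + d := fun d hd => le_add_of_nonneg_right hd.1
  refine ⟨?_, fun s hs d hd r hr hdr => ?_, fun s hs => ?_, fun r hr => ?_, fun r hr => ?_,
    fun y hy t ht => ?_⟩
  · have hw0 : Continuous fun d => w d 0 + d :=
      (hw.comp (Continuous.prodMk_left 0)).add continuous_id
    exact (continuous_lowPass hw0 hw).continuousOn.congr fun p hp => hβ p.1 hp.1 p.2 hp.2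
  · have hmono : ∀ t, 0 ≤ t → w d t ≤ w r t := fun t ht => by
      rw [hweq d hd t ht, hweq r hr t ht]
      exact monotoneOn_deltaMax hm h hg hC hΔt hdec hstrict hfix ht hd hr hdr.le
    simp only [hβ d hd s hs, hβ r hr s hs]
    exact lowPass_lt_lowPass hα.le (hwd d) (hwd r) hs
      (add_lt_add_of_le_of_lt (hmono 0 le_rfl) hdr) fun t ht => hmono t ht.1
  · rw [betaFn_eq_lowPass, lowPass_congr (v := fun _ => 0) hs fun t ht =>
      deltaMax_zero hm hΔt.le hfix ht.1, deltaMax_zero hm hΔt.le hfix le_rfl]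
    simp [lowPass]
  · exact (antitoneOn_lowPass hα.le (hwd r) (hwanti r hr) (hz r hr)).congr
      fun t ht => (hβ r hr t ht).symm
  · exact (tendsto_lowPass hα (hwd r) (hwanti r hr) (hz r hr) (hwlim r hr)).congr'
      ((eventually_ge_atTop 0).mono fun t ht => (hβ r hr t ht).symm)
  · have hd : ‖yg - y‖ ∈ Icc 0 D := by
      rw [mem_closedBall, dist_comm, dist_eq_norm] at hy
      exact ⟨norm_nonneg _, hy⟩
    have hle : deltaFn yg Φ y t ≤ deltaMax yg Φ Δt ‖yg - y‖ t :=
      deltaFn_le_deltaMax h hd.2 ht (by rw [mem_sphere, dist_comm, dist_eq_norm])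
        ⟨le_rfl, by linarith⟩
    rw [hβ _ hd t ht]
    rw [← hweq _ hd t ht] at hle
    exact hle.trans (le_lowPass hα.le (hwd _) (hwanti _ hd) (hz _ hd) ht)
end

section
/- If the surrogate stability conditions hold, then δ(y_g, t) = 0 for all t ≥ 0; equivalently, Φ(t, y_g) = y_g for all t ≥ 0, so y_g is an equilibrium of the flow. -/
open Metric Set Filter Topology

theorem stmt_6
    (m : ℕ) (hm : 1 ≤ m)
    (yg : EuclideanSpace ℝ (Fin m)) (D : ℝ) (hD : 0 < D)
    (f : EuclideanSpace ℝ (Fin m) → EuclideanSpace ℝ (Fin m))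
    (hf : ContDiff ℝ 1 f)
    (Φ : ℝ → EuclideanSpace ℝ (Fin m) → EuclideanSpace ℝ (Fin m))
    (hΦ0 : ∀ y₀ ∈ Metric.closedBall yg D, Φ 0 y₀ = y₀)
    (hΦinv : ∀ t : ℝ, 0 ≤ t → ∀ y₀ ∈ Metric.closedBall yg D,
      Φ t y₀ ∈ Metric.closedBall yg D)
    (hΦderiv : ∀ t : ℝ, 0 ≤ t → ∀ y₀ ∈ Metric.closedBall yg D,
      HasDerivAt (fun τ => Φ τ y₀) (f (Φ t y₀)) t)
    (hΦflow : ∀ s : ℝ, 0 ≤ s → ∀ t : ℝ, 0 ≤ t → ∀ y₀ ∈ Metric.closedBall yg D,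
      Φ (s + t) y₀ = Φ t (Φ s y₀))
    (Δt : ℝ) (hΔt : 0 < Δt)
    (hsur1 : ∀ t : ℝ, 0 ≤ t → deltaFn yg Φ yg (t + Δt) = deltaFn yg Φ yg t)
    (hsur2 : ∀ t : ℝ, 0 ≤ t → ∀ y₀ ∈ Metric.closedBall yg D, y₀ ≠ yg →
      deltaFn yg Φ y₀ (t + Δt) < deltaFn yg Φ y₀ t)
    :
    (∀ t : ℝ, 0 ≤ t → deltaFn yg Φ yg t = 0) ∧
    (∀ t : ℝ, 0 ≤ t → Φ t yg = yg) := by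
  have hyg : yg ∈ Metric.closedBall yg D := Metric.mem_closedBall_self hD.le
  have hfix : ∀ t : ℝ, 0 ≤ t → Φ t yg = yg := by
    intro t ht
    by_contra hne
    have hmem := hΦinv t ht yg hyg
    have hlt := hsur2 0 le_rfl (Φ t yg) hmem hne
    have heq := hsur1 t ht
    simp only [deltaFn, zero_add] at hlt heq
    rw [hΦ0 _ hmem, ← hΦflow t ht Δt hΔt.le yg hyg] at hlt
    exact hlt.ne heq
  exact ⟨fun t ht => by simp [deltaFn, hfix t ht], hfix⟩
end

section
/- Suppose that for every d₀ ∈ (0, D] the map t ↦ δmax(d₀, t) is non-increasing on ℝ≥0. Then for every d₀ ∈ (0, D]: (i) β(d₀, t) > δmax(d₀, t) for all t ≥ 0, and hence β(d₀, t) > δ(y₀, t) for all t ≥ 0 and all y₀ with ‖y_g − y₀‖ = d₀; and (ii) the map t ↦ β(d₀, t) is strictly decreasing on ℝ≥0. -/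
open Metric Set Filter Topology

open MeasureTheory in
theorem AntitoneOn.intervalIntegrable_exp_mul {g : ℝ → ℝ} {a b : ℝ} (α c : ℝ) (hab : a ≤ b)
    (hg : AntitoneOn g (Icc a b)) :
    IntervalIntegrable (fun s => Real.exp (α * (c - s)) * g s) volume a b := by
  rw [← uIcc_of_le hab] at hg
  exact hg.intervalIntegrable.continuousOn_mul (by fun_prop)

theorem neg_mul_integral_exp_mul_sub (α a b : ℝ) :
    -α * ∫ s in a..b, Real.exp (α * (b - s)) = 1 - Real.exp (α * (b - a)) := by
  rw [← intervalIntegral.integral_const_mul,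
    intervalIntegral.integral_eq_sub_of_hasDerivAt (f := fun s => Real.exp (α * (b - s)))]
  · simp
  · intro x _
    exact (((hasDerivAt_id' x).const_sub b).const_mul α).exp.congr_deriv (by ring)
  · exact Continuous.intervalIntegrable (by fun_prop) _ _

theorem AntitoneOn.mul_one_sub_exp_le_neg_mul_integral {g : ℝ → ℝ} {α a b : ℝ} (hα : α < 0)
    (hab : a ≤ b) (hg : AntitoneOn g (Icc a b)) :
    g b * (1 - Real.exp (α * (b - a))) ≤ -α * ∫ s in a..b, Real.exp (α * (b - s)) * g s := by
  rw [← neg_mul_integral_exp_mul_sub, mul_left_comm, mul_comm (g b),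
    ← intervalIntegral.integral_mul_const]
  refine mul_le_mul_of_nonneg_left ?_ (by linarith)
  refine intervalIntegral.integral_mono_on hab
    (Continuous.intervalIntegrable (by fun_prop) _ _) (hg.intervalIntegrable_exp_mul α b hab) ?_
  intro s hs
  exact mul_le_mul_of_nonneg_left (hg hs (right_mem_Icc.2 hab) hs.2) (Real.exp_pos _).le

theorem AntitoneOn.neg_mul_integral_le_mul_one_sub_exp {g : ℝ → ℝ} {α a b : ℝ} (hα : α < 0)
    (hab : a ≤ b) (hg : AntitoneOn g (Icc a b)) :
    -α * ∫ s in a..b, Real.exp (α * (b - s)) * g s ≤ g a * (1 - Real.exp (α * (b - a))) := by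
  rw [← neg_mul_integral_exp_mul_sub, mul_left_comm, mul_comm (g a),
    ← intervalIntegral.integral_mul_const]
  refine mul_le_mul_of_nonneg_left ?_ (by linarith)
  refine intervalIntegral.integral_mono_on hab (hg.intervalIntegrable_exp_mul α b hab)
    (Continuous.intervalIntegrable (by fun_prop) _ _) ?_
  intro s hs
  exact mul_le_mul_of_nonneg_left (hg (left_mem_Icc.2 hab) hs hs.1) (Real.exp_pos _).le

section Envelope

variable {m : ℕ} {yg : EuclideanSpace ℝ (Fin m)}
  {Φ : ℝ → EuclideanSpace ℝ (Fin m) → EuclideanSpace ℝ (Fin m)} {D Δt α d₀ : ℝ}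

theorem deltaFn_le_deltaMax_s8
    (hΦinv : ∀ t : ℝ, 0 ≤ t → ∀ y₀ ∈ Metric.closedBall yg D, Φ t y₀ ∈ Metric.closedBall yg D)
    (hΔt : 0 ≤ Δt) (hd₀ : d₀ ≤ D) {t : ℝ} (ht : 0 ≤ t) {y₀ : EuclideanSpace ℝ (Fin m)}
    (hy₀ : y₀ ∈ Metric.sphere yg d₀) :
    deltaFn yg Φ y₀ t ≤ deltaMax yg Φ Δt d₀ t := by
  have bound : ∀ y ∈ Metric.sphere yg d₀, ∀ s ∈ Icc t (t + Δt), deltaFn yg Φ y s ≤ D := by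
    intro y hy s hs
    have h := hΦinv s (ht.trans hs.1) y
      (Metric.closedBall_subset_closedBall hd₀ (Metric.sphere_subset_closedBall hy))
    rwa [Metric.mem_closedBall, dist_comm, dist_eq_norm] at h
  have mem : t ∈ Icc t (t + Δt) := left_mem_Icc.2 (by linarith)
  calc deltaFn yg Φ y₀ t ≤ deltaMaxW yg Φ Δt y₀ t :=
        le_csSup ⟨D, forall_mem_image.2 (bound y₀ hy₀)⟩ (mem_image_of_mem _ mem)
    _ ≤ deltaMax yg Φ Δt d₀ t := by
        refine le_csSup ⟨D, forall_mem_image.2 fun y hy => ?_⟩ (mem_image_of_mem _ hy₀)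
        exact csSup_le ⟨_, mem_image_of_mem _ mem⟩ (forall_mem_image.2 (bound y hy))

theorem deltaMax_lt_betaFn (hα : α < 0) (hd₀ : 0 < d₀)
    (hmono : AntitoneOn (deltaMax yg Φ Δt d₀) (Ici 0)) {t : ℝ} (ht : 0 ≤ t) :
    deltaMax yg Φ Δt d₀ t < betaFn yg Φ Δt α d₀ t := by
  have h := (hmono.mono Icc_subset_Ici_self).mul_one_sub_exp_le_neg_mul_integral hα ht
  have h0 : deltaMax yg Φ Δt d₀ t ≤ deltaMax yg Φ Δt d₀ 0 := hmono self_mem_Ici ht ht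
  rw [sub_zero] at h
  unfold betaFn
  nlinarith [mul_pos (Real.exp_pos (α * t)) hd₀,
    mul_le_mul_of_nonneg_left h0 (Real.exp_pos (α * t)).le]

theorem betaFn_eq_exp_mul_sub (hmono : AntitoneOn (deltaMax yg Φ Δt d₀) (Ici 0))
    {a b : ℝ} (ha : 0 ≤ a) (hab : a ≤ b) :
    betaFn yg Φ Δt α d₀ b = Real.exp (α * (b - a)) * betaFn yg Φ Δt α d₀ a
      - α * ∫ s in a..b, Real.exp (α * (b - s)) * deltaMax yg Φ Δt d₀ s := by
  have split := intervalIntegral.integral_add_adjacent_intervals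
    ((hmono.mono Icc_subset_Ici_self).intervalIntegrable_exp_mul α b ha)
    ((hmono.mono (Icc_subset_Ici_self.trans (Ici_subset_Ici.2 ha))).intervalIntegrable_exp_mul
      α b hab)
  have shift : ∫ s in (0:ℝ)..a, Real.exp (α * (b - s)) * deltaMax yg Φ Δt d₀ s
      = Real.exp (α * (b - a)) *
        ∫ s in (0:ℝ)..a, Real.exp (α * (a - s)) * deltaMax yg Φ Δt d₀ s := by
    rw [← intervalIntegral.integral_const_mul]
    congr 1 with s
    rw [← mul_assoc, ← Real.exp_add]
    ring_nf
  have hexp : Real.exp (α * b) = Real.exp (α * (b - a)) * Real.exp (α * a) := by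
    rw [← Real.exp_add]
    ring_nf
  unfold betaFn
  rw [← split, shift, hexp]
  ring

theorem strictAntiOn_betaFn (hα : α < 0) (hd₀ : 0 < d₀)
    (hmono : AntitoneOn (deltaMax yg Φ Δt d₀) (Ici 0)) :
    StrictAntiOn (betaFn yg Φ Δt α d₀) (Ici 0) := by
  intro a ha b _ hab
  have h := (hmono.mono
    (Icc_subset_Ici_self.trans (Ici_subset_Ici.2 ha))).neg_mul_integral_le_mul_one_sub_exp hα hab.le
  have hlt := deltaMax_lt_betaFn hα hd₀ hmono ha
  have hexp : Real.exp (α * (b - a)) < 1 :=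
    Real.exp_lt_one_iff.2 (mul_neg_of_neg_of_pos hα (sub_pos.2 hab))
  rw [betaFn_eq_exp_mul_sub hmono ha hab.le]
  nlinarith [mul_pos (sub_pos.2 hlt) (sub_pos.2 hexp)]

end Envelope

theorem stmt_8
    (m : ℕ) (hm : 1 ≤ m)
    (yg : EuclideanSpace ℝ (Fin m)) (D : ℝ) (hD : 0 < D)
    (f : EuclideanSpace ℝ (Fin m) → EuclideanSpace ℝ (Fin m))
    (hf : ContDiff ℝ 1 f)
    (Φ : ℝ → EuclideanSpace ℝ (Fin m) → EuclideanSpace ℝ (Fin m))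
    (hΦ0 : ∀ y₀ ∈ Metric.closedBall yg D, Φ 0 y₀ = y₀)
    (hΦinv : ∀ t : ℝ, 0 ≤ t → ∀ y₀ ∈ Metric.closedBall yg D,
      Φ t y₀ ∈ Metric.closedBall yg D)
    (hΦderiv : ∀ t : ℝ, 0 ≤ t → ∀ y₀ ∈ Metric.closedBall yg D,
      HasDerivAt (fun τ => Φ τ y₀) (f (Φ t y₀)) t)
    (hΦflow : ∀ s : ℝ, 0 ≤ s → ∀ t : ℝ, 0 ≤ t → ∀ y₀ ∈ Metric.closedBall yg D,
      Φ (s + t) y₀ = Φ t (Φ s y₀))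
    (Δt : ℝ) (hΔt : 0 < Δt) (α : ℝ) (hα : α < 0)
    (hmono : ∀ d₀ ∈ Set.Ioc (0:ℝ) D,
      AntitoneOn (fun t => deltaMax yg Φ Δt d₀ t) (Set.Ici 0)) :
    ∀ d₀ ∈ Set.Ioc (0:ℝ) D,
      (∀ t : ℝ, 0 ≤ t → deltaMax yg Φ Δt d₀ t < betaFn yg Φ Δt α d₀ t) ∧
      (∀ t : ℝ, 0 ≤ t → ∀ y₀ : EuclideanSpace ℝ (Fin m), ‖yg - y₀‖ = d₀ →
        deltaFn yg Φ y₀ t < betaFn yg Φ Δt α d₀ t) ∧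
      StrictAntiOn (fun t => betaFn yg Φ Δt α d₀ t) (Set.Ici 0) := by
  intro d₀ hd₀
  have lt_beta : ∀ t : ℝ, 0 ≤ t → deltaMax yg Φ Δt d₀ t < betaFn yg Φ Δt α d₀ t :=
    fun t ht => deltaMax_lt_betaFn hα hd₀.1 (hmono d₀ hd₀) ht
  refine ⟨lt_beta, fun t ht y₀ hy₀ => ?_, strictAntiOn_betaFn hα hd₀.1 (hmono d₀ hd₀)⟩
  have hmem : y₀ ∈ Metric.sphere yg d₀ := by
    rwa [Metric.mem_sphere, dist_comm, dist_eq_norm]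
  exact (deltaFn_le_deltaMax_s8 hΦinv hΔt.le hd₀.2 ht hmem).trans_lt (lt_beta t ht)
end

section
/- Suppose δ(y₀, t + Δt) < δ(y₀, t) for all t ≥ 0 and all y₀ ∈ 𝓛 with y₀ ≠ y_g. Then for every d₀ ∈ (0, D], the map t ↦ δmax(d₀, t) is non-increasing on ℝ≥0. -/
open Metric Set Filter Topology

/-- If shifting by a period `T > 0` does not increase `g` on `[0, ∞)`, then every value of `g` on
`[a, ∞)` is bounded by a value on `[a, a + T]`. -/
theorem exists_mem_Icc_le_of_add_le {g : ℝ → ℝ} {T : ℝ} (hT : 0 < T)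
    (hg : ∀ t, 0 ≤ t → g (t + T) ≤ g t) {a s : ℝ} (ha : 0 ≤ a) (has : a ≤ s) :
    ∃ r ∈ Set.Icc a (a + T), g s ≤ g r := by
  have hshift : ∀ (n : ℕ) (r : ℝ), 0 ≤ r → g (r + n * T) ≤ g r := by
    intro n
    induction n with
    | zero => intro r _; simp
    | succ k ih =>
      intro r hr
      have h := hg (r + k * T) (by positivity)
      have heq : r + ((k + 1 : ℕ) : ℝ) * T = r + k * T + T := by push_cast; ring
      rw [heq]
      exact h.trans (ih r hr)
  have hnonneg : 0 ≤ (s - a) / T := div_nonneg (sub_nonneg.2 has) hT.le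
  have hle : (⌊(s - a) / T⌋₊ : ℝ) * T ≤ s - a := (le_div_iff₀ hT).1 (Nat.floor_le hnonneg)
  have hlt : s - a < ((⌊(s - a) / T⌋₊ : ℝ) + 1) * T :=
    (div_lt_iff₀ hT).1 (Nat.lt_floor_add_one _)
  refine ⟨s - ⌊(s - a) / T⌋₊ * T, ⟨by linarith, by linarith⟩, ?_⟩
  have h := hshift ⌊(s - a) / T⌋₊ (s - ⌊(s - a) / T⌋₊ * T) (by linarith)
  rwa [sub_add_cancel] at h

theorem stmt_9
    (m : ℕ) (hm : 1 ≤ m)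
    (yg : EuclideanSpace ℝ (Fin m)) (D : ℝ) (hD : 0 < D)
    (f : EuclideanSpace ℝ (Fin m) → EuclideanSpace ℝ (Fin m))
    (hf : ContDiff ℝ 1 f)
    (Φ : ℝ → EuclideanSpace ℝ (Fin m) → EuclideanSpace ℝ (Fin m))
    (hΦ0 : ∀ y₀ ∈ Metric.closedBall yg D, Φ 0 y₀ = y₀)
    (hΦinv : ∀ t : ℝ, 0 ≤ t → ∀ y₀ ∈ Metric.closedBall yg D,
      Φ t y₀ ∈ Metric.closedBall yg D)
    (hΦderiv : ∀ t : ℝ, 0 ≤ t → ∀ y₀ ∈ Metric.closedBall yg D,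
      HasDerivAt (fun τ => Φ τ y₀) (f (Φ t y₀)) t)
    (hΦflow : ∀ s : ℝ, 0 ≤ s → ∀ t : ℝ, 0 ≤ t → ∀ y₀ ∈ Metric.closedBall yg D,
      Φ (s + t) y₀ = Φ t (Φ s y₀))
    (Δt : ℝ) (hΔt : 0 < Δt)
    (hsur2 : ∀ t : ℝ, 0 ≤ t → ∀ y₀ ∈ Metric.closedBall yg D, y₀ ≠ yg →
      deltaFn yg Φ y₀ (t + Δt) < deltaFn yg Φ y₀ t) :
    ∀ d₀ ∈ Set.Ioc (0:ℝ) D,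
      AntitoneOn (fun t => deltaMax yg Φ Δt d₀ t) (Set.Ici 0) := by
  rintro d₀ ⟨hd₀, hd₀D⟩ a ha b hb hab
  rw [Set.mem_Ici] at ha hb
  have hball : ∀ y ∈ Metric.sphere yg d₀, y ∈ Metric.closedBall yg D := fun y hy =>
    Metric.closedBall_subset_closedBall hd₀D (Metric.sphere_subset_closedBall hy)
  have hbound : ∀ y ∈ Metric.sphere yg d₀, ∀ t, 0 ≤ t → deltaFn yg Φ y t ≤ D := by
    intro y hy t ht
    have h := hΦinv t ht y (hball y hy)
    rwa [Metric.mem_closedBall, dist_comm, dist_eq_norm] at h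
  have hne : ∀ t : ℝ, (Set.Icc t (t + Δt)).Nonempty := fun t =>
    Set.nonempty_Icc.2 (by linarith)
  have hW : ∀ y ∈ Metric.sphere yg d₀, deltaMaxW yg Φ Δt y b ≤ deltaMaxW yg Φ Δt y a := by
    intro y hy
    refine csSup_le ((hne b).image _) ?_
    rintro _ ⟨s, hs, rfl⟩
    obtain ⟨r, hr, hsr⟩ := exists_mem_Icc_le_of_add_le hΔt
      (fun t ht => (hsur2 t ht y (hball y hy) (Metric.ne_of_mem_sphere hy hd₀.ne')).le)
      ha (hab.trans hs.1)
    refine hsr.trans (le_csSup ⟨D, ?_⟩ (Set.mem_image_of_mem _ hr))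
    rintro _ ⟨u, hu, rfl⟩
    exact hbound y hy u (ha.trans hu.1)
  have hbdd : BddAbove ((fun y => deltaMaxW yg Φ Δt y a) '' Metric.sphere yg d₀) := by
    refine ⟨D, ?_⟩
    rintro _ ⟨y, hy, rfl⟩
    refine csSup_le ((hne a).image _) ?_
    rintro _ ⟨u, hu, rfl⟩
    exact hbound y hy u (ha.trans hu.1)
  change sSup _ ≤ sSup _
  rcases (Metric.sphere yg d₀).eq_empty_or_nonempty with h | h
  · simp [h]
  · refine csSup_le (h.image _) ?_
    rintro _ ⟨y, hy, rfl⟩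
    exact (hW y hy).trans (le_csSup hbdd (Set.mem_image_of_mem _ hy))
end

section
/- Let Δt > 0 and let g : ℝ≥0 → ℝ be continuous with g(s + Δt) < g(s) for all s ≥ 0. Then the sliding-window maximum M(t) = max_{s ∈ [t, t+Δt]} g(s) (which exists since g is continuous and [t, t+Δt] is compact) is a non-increasing function of t on ℝ≥0. -/
open Metric Set Filter Topology

theorem apply_add_nat_mul_le_of_apply_add_lt {Δt : ℝ} (hΔt : 0 < Δt) {g : ℝ → ℝ}
    (hdec : ∀ s : ℝ, 0 ≤ s → g (s + Δt) < g s) {s : ℝ} (hs : 0 ≤ s) (n : ℕ) :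
    g (s + n * Δt) ≤ g s := by
  induction n with
  | zero => simp
  | succ n ih =>
    have h := hdec (s + n * Δt) (by positivity)
    rw [show s + ((n + 1 : ℕ) : ℝ) * Δt = s + n * Δt + Δt by push_cast; ring]
    exact h.le.trans ih

theorem stmt_10
    (Δt : ℝ) (hΔt : 0 < Δt) (g : ℝ → ℝ)
    (hg : ContinuousOn g (Set.Ici 0))
    (hdec : ∀ s : ℝ, 0 ≤ s → g (s + Δt) < g s) :
    AntitoneOn (fun t => sSup (g '' Set.Icc t (t + Δt))) (Set.Ici 0) := by
  intro a ha b _ hab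
  have ha0 : 0 ≤ a := ha
  have hbdd : BddAbove (g '' Set.Icc a (a + Δt)) :=
    (isCompact_Icc.image_of_continuousOn (hg.mono fun x hx => ha0.trans hx.1)).bddAbove
  refine csSup_le ((nonempty_Icc.2 (by linarith)).image g) ?_
  rintro _ ⟨x, hx, rfl⟩
  have hxa : 0 ≤ (x - a) / Δt := div_nonneg (by linarith [hx.1]) hΔt.le
  set n := ⌊(x - a) / Δt⌋₊
  have h₁ : n * Δt ≤ x - a := (le_div_iff₀ hΔt).1 (Nat.floor_le hxa)
  have h₂ : x - a < (n + 1) * Δt := (div_lt_iff₀ hΔt).1 (Nat.lt_floor_add_one _)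
  have h := apply_add_nat_mul_le_of_apply_add_lt hΔt hdec (s := x - n * Δt) (by linarith) n
  rw [sub_add_cancel] at h
  exact h.trans (le_csSup hbdd ⟨_, ⟨by linarith, by linarith⟩, rfl⟩)
end

section
/- For each fixed d₀ ∈ [0, D], the map t ↦ δmax(d₀, t) is continuous on ℝ≥0. -/
open Metric Set Filter Topology

theorem abs_sSup_image_sub_sSup_image_le {α : Type*} {S : Set α} {F G : α → ℝ} {c : ℝ}
    (hc : 0 ≤ c) (hF : BddAbove (F '' S)) (hG : BddAbove (G '' S))
    (h : ∀ x ∈ S, |F x - G x| ≤ c) :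
    |sSup (F '' S) - sSup (G '' S)| ≤ c := by
  rcases S.eq_empty_or_nonempty with rfl | hS
  · simpa using hc
  have hFG : sSup (F '' S) ≤ sSup (G '' S) + c := by
    refine csSup_le (hS.image F) ?_
    rintro _ ⟨x, hx, rfl⟩
    have h₁ := (abs_le.mp (h x hx)).2
    have h₂ := le_csSup hG (mem_image_of_mem G hx)
    linarith
  have hGF : sSup (G '' S) ≤ sSup (F '' S) + c := by
    refine csSup_le (hS.image G) ?_
    rintro _ ⟨x, hx, rfl⟩
    have h₁ := (abs_le.mp (h x hx)).1
    have h₂ := le_csSup hF (mem_image_of_mem F hx)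
    linarith
  rw [abs_le]
  constructor <;> linarith

theorem image_Icc_add_eq_image_comp_add (g : ℝ → ℝ) (t r : ℝ) :
    g '' Icc t (t + r) = (fun u => g (t + u)) '' Icc 0 r := by
  have h : Icc t (t + r) = (fun u => t + u) '' Icc 0 r := by simp [add_comm]
  rw [h, image_image]

theorem abs_deltaFn_sub_le {m : ℕ} {yg : EuclideanSpace ℝ (Fin m)}
    {Φ : ℝ → EuclideanSpace ℝ (Fin m) → EuclideanSpace ℝ (Fin m)}
    {f : EuclideanSpace ℝ (Fin m) → EuclideanSpace ℝ (Fin m)}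
    {y₀ : EuclideanSpace ℝ (Fin m)} {C : ℝ}
    (hderiv : ∀ t : ℝ, 0 ≤ t → HasDerivAt (fun τ => Φ τ y₀) (f (Φ t y₀)) t)
    (hC : ∀ t : ℝ, 0 ≤ t → ‖f (Φ t y₀)‖ ≤ C) {s t : ℝ} (hs : 0 ≤ s) (ht : 0 ≤ t) :
    |deltaFn yg Φ y₀ s - deltaFn yg Φ y₀ t| ≤ C * |s - t| := by
  have h := (convex_Ici (0 : ℝ)).norm_image_sub_le_of_norm_hasDerivWithin_le
    (fun x hx => (hderiv x hx).hasDerivWithinAt) (fun x hx => hC x hx)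
    (mem_Ici.mpr hs) (mem_Ici.mpr ht)
  have h' := abs_norm_sub_norm_le (yg - Φ s y₀) (yg - Φ t y₀)
  rw [sub_sub_sub_cancel_left] at h'
  rw [abs_sub_comm s t]
  exact h'.trans h

theorem stmt_12
    (m : ℕ) (hm : 1 ≤ m)
    (yg : EuclideanSpace ℝ (Fin m)) (D : ℝ) (hD : 0 < D)
    (f : EuclideanSpace ℝ (Fin m) → EuclideanSpace ℝ (Fin m))
    (hf : ContDiff ℝ 1 f)
    (Φ : ℝ → EuclideanSpace ℝ (Fin m) → EuclideanSpace ℝ (Fin m))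
    (hΦ0 : ∀ y₀ ∈ Metric.closedBall yg D, Φ 0 y₀ = y₀)
    (hΦinv : ∀ t : ℝ, 0 ≤ t → ∀ y₀ ∈ Metric.closedBall yg D,
      Φ t y₀ ∈ Metric.closedBall yg D)
    (hΦderiv : ∀ t : ℝ, 0 ≤ t → ∀ y₀ ∈ Metric.closedBall yg D,
      HasDerivAt (fun τ => Φ τ y₀) (f (Φ t y₀)) t)
    (hΦflow : ∀ s : ℝ, 0 ≤ s → ∀ t : ℝ, 0 ≤ t → ∀ y₀ ∈ Metric.closedBall yg D,
      Φ (s + t) y₀ = Φ t (Φ s y₀))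
    (Δt : ℝ) (hΔt : 0 < Δt) :
    ∀ d₀ ∈ Set.Icc (0:ℝ) D,
      ContinuousOn (fun t => deltaMax yg Φ Δt d₀ t) (Set.Ici 0) := by
  rintro d₀ ⟨-, hd₀⟩
  obtain ⟨C, hC⟩ := (isCompact_closedBall yg D).exists_bound_of_continuousOn
    hf.continuous.continuousOn
  have hC0 : 0 ≤ C := (norm_nonneg _).trans (hC yg (mem_closedBall_self hD.le))
  have hbound : ∀ y₀ ∈ closedBall yg D, ∀ t : ℝ, 0 ≤ t → deltaFn yg Φ y₀ t ≤ D := by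
    intro y₀ hy₀ t ht
    simpa [deltaFn, dist_eq_norm, norm_sub_rev] using hΦinv t ht y₀ hy₀
  have hbddW : ∀ y₀ ∈ closedBall yg D, ∀ t : ℝ, 0 ≤ t →
      D ∈ upperBounds ((fun u => deltaFn yg Φ y₀ (t + u)) '' Icc 0 Δt) := by
    rintro y₀ hy₀ t ht _ ⟨u, hu, rfl⟩
    exact hbound y₀ hy₀ _ (add_nonneg ht hu.1)
  have hsub : sphere yg d₀ ⊆ closedBall yg D :=
    sphere_subset_closedBall.trans (closedBall_subset_closedBall hd₀)
  have hbdd : ∀ t : ℝ, 0 ≤ t →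
      BddAbove ((fun y₀ => deltaMaxW yg Φ Δt y₀ t) '' sphere yg d₀) := by
    refine fun t ht => ⟨D, ?_⟩
    rintro _ ⟨y₀, hy₀, rfl⟩
    simp only [deltaMaxW, image_Icc_add_eq_image_comp_add]
    exact csSup_le ((nonempty_Icc.mpr hΔt.le).image _) (hbddW y₀ (hsub hy₀) t ht)
  have hlip : LipschitzOnWith C.toNNReal (fun t => deltaMax yg Φ Δt d₀ t) (Ici 0) := by
    refine LipschitzOnWith.of_dist_le_mul fun s hs t ht => ?_
    rw [Real.coe_toNNReal C hC0, Real.dist_eq, Real.dist_eq]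
    have hc : 0 ≤ C * |s - t| := mul_nonneg hC0 (abs_nonneg _)
    refine abs_sSup_image_sub_sSup_image_le hc (hbdd s hs) (hbdd t ht) fun y₀ hy₀ => ?_
    have hy := hsub hy₀
    simp only [deltaMaxW, image_Icc_add_eq_image_comp_add]
    refine abs_sSup_image_sub_sSup_image_le hc ⟨D, hbddW y₀ hy s hs⟩
      ⟨D, hbddW y₀ hy t ht⟩ fun u hu => ?_
    have h := abs_deltaFn_sub_le (yg := yg) (fun r hr => hΦderiv r hr y₀ hy)
      (fun r hr => hC _ (hΦinv r hr y₀ hy))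
      (add_nonneg (mem_Ici.mp hs) hu.1) (add_nonneg (mem_Ici.mp ht) hu.1)
    rwa [add_sub_add_right_eq_sub] at h
  exact hlip.continuousOn
end

section
/- For each fixed t ≥ 0, the map d₀ ↦ δmax(d₀, t) is continuous on [0, D]. -/
open Metric Set Filter Topology

theorem csSup_image_le_csSup_image_add {α β : Type*} {g : α → ℝ} {h : β → ℝ} {S : Set α}
    {T : Set β} {ε : ℝ} (hS : S.Nonempty) (hT : BddAbove (h '' T))
    (H : ∀ x ∈ S, ∃ y ∈ T, g x ≤ h y + ε) : sSup (g '' S) ≤ sSup (h '' T) + ε := by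
  apply csSup_le (hS.image g)
  rintro _ ⟨x, hx, rfl⟩
  obtain ⟨y, hy, hxy⟩ := H x hx
  linarith [le_csSup hT (mem_image_of_mem h hy)]

theorem exists_mem_sphere_dist_eq_abs_sub {E : Type*} [NormedAddCommGroup E] [NormedSpace ℝ E]
    [Nontrivial E] {x y : E} {r r' : ℝ} (hr' : 0 ≤ r') (hy : y ∈ sphere x r) :
    ∃ y' ∈ sphere x r', dist y y' = |r - r'| := by
  obtain ⟨u, hu, hyu⟩ : ∃ u : E, ‖u‖ = 1 ∧ y = x + r • u := by
    rw [mem_sphere, dist_eq_norm] at hy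
    rcases eq_or_ne r 0 with rfl | hr
    · obtain ⟨u, hu⟩ := exists_norm_eq E zero_le_one
      exact ⟨u, hu, by simpa [sub_eq_zero] using hy⟩
    · refine ⟨r⁻¹ • (y - x), ?_, by simp [smul_smul, hr]⟩
      rw [norm_smul, hy, norm_inv, Real.norm_eq_abs, abs_of_nonneg (hy ▸ norm_nonneg _),
        inv_mul_cancel₀ hr]
  refine ⟨x + r' • u, ?_, ?_⟩
  · simp [norm_smul, hu, abs_of_nonneg hr']
  · rw [hyu, dist_add_left, dist_eq_norm, ← sub_smul, norm_smul, hu, mul_one, Real.norm_eq_abs]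

theorem dist_flow_le {E : Type*} [NormedAddCommGroup E] [NormedSpace ℝ E] {f : E → E}
    {Φ : ℝ → E → E} {B : Set E} {K : NNReal} (hK : LipschitzOnWith K f B)
    (hΦ0 : ∀ y ∈ B, Φ 0 y = y) (hΦinv : ∀ t : ℝ, 0 ≤ t → ∀ y ∈ B, Φ t y ∈ B)
    (hΦderiv : ∀ t : ℝ, 0 ≤ t → ∀ y ∈ B, HasDerivAt (fun τ => Φ τ y) (f (Φ t y)) t)
    {y z : E} (hy : y ∈ B) (hz : z ∈ B) {t : ℝ} (ht : 0 ≤ t) :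
    dist (Φ t y) (Φ t z) ≤ dist y z * Real.exp (K * t) := by
  have h := dist_le_of_trajectories_ODE_of_mem (v := fun _ => f) (s := fun _ => B) (K := K)
    (f := fun τ => Φ τ y) (g := fun τ => Φ τ z) (a := 0) (b := t) (δ := dist y z)
    (fun _ _ => hK)
    (fun τ hτ => (hΦderiv τ hτ.1 y hy).continuousAt.continuousWithinAt)
    (fun τ hτ => (hΦderiv τ hτ.1 y hy).hasDerivWithinAt)
    (fun τ hτ => hΦinv τ hτ.1 y hy)
    (fun τ hτ => (hΦderiv τ hτ.1 z hz).continuousAt.continuousWithinAt)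
    (fun τ hτ => (hΦderiv τ hτ.1 z hz).hasDerivWithinAt)
    (fun τ hτ => hΦinv τ hτ.1 z hz)
    (by rw [hΦ0 y hy, hΦ0 z hz]) t ⟨ht, le_rfl⟩
  simpa using h


theorem stmt_13
    (m : ℕ) (hm : 1 ≤ m)
    (yg : EuclideanSpace ℝ (Fin m)) (D : ℝ) (hD : 0 < D)
    (f : EuclideanSpace ℝ (Fin m) → EuclideanSpace ℝ (Fin m))
    (hf : ContDiff ℝ 1 f)
    (Φ : ℝ → EuclideanSpace ℝ (Fin m) → EuclideanSpace ℝ (Fin m))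
    (hΦ0 : ∀ y₀ ∈ Metric.closedBall yg D, Φ 0 y₀ = y₀)
    (hΦinv : ∀ t : ℝ, 0 ≤ t → ∀ y₀ ∈ Metric.closedBall yg D,
      Φ t y₀ ∈ Metric.closedBall yg D)
    (hΦderiv : ∀ t : ℝ, 0 ≤ t → ∀ y₀ ∈ Metric.closedBall yg D,
      HasDerivAt (fun τ => Φ τ y₀) (f (Φ t y₀)) t)
    (hΦflow : ∀ s : ℝ, 0 ≤ s → ∀ t : ℝ, 0 ≤ t → ∀ y₀ ∈ Metric.closedBall yg D,
      Φ (s + t) y₀ = Φ t (Φ s y₀))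
    (Δt : ℝ) (hΔt : 0 < Δt) :
    ∀ t : ℝ, 0 ≤ t →
      ContinuousOn (fun d₀ => deltaMax yg Φ Δt d₀ t) (Set.Icc 0 D) := by
  intro t ht
  have : NeZero m := ⟨by omega⟩
  obtain ⟨K, hK⟩ := hf.contDiffOn.exists_lipschitzOnWith one_ne_zero
    (convex_closedBall yg D) (isCompact_closedBall yg D)
  have hδ_le : ∀ y ∈ closedBall yg D, ∀ s ∈ Icc t (t + Δt), deltaFn yg Φ y s ≤ D :=
    fun y hy s hs => by
      have h := hΦinv s (ht.trans hs.1) y hy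
      rwa [mem_closedBall', dist_eq_norm] at h
  have hW_bdd : ∀ y ∈ closedBall yg D,
      BddAbove ((fun s => deltaFn yg Φ y s) '' Icc t (t + Δt)) := fun y hy =>
    ⟨D, by rintro _ ⟨s, hs, rfl⟩; exact hδ_le y hy s hs⟩
  have hIcc : (Icc t (t + Δt)).Nonempty := nonempty_Icc.2 (by linarith)
  have hW_le : ∀ y ∈ closedBall yg D, deltaMaxW yg Φ Δt y t ≤ D := fun y hy =>
    csSup_le (hIcc.image _) (by rintro _ ⟨s, hs, rfl⟩; exact hδ_le y hy s hs)
  have hW_lip : ∀ y ∈ closedBall yg D, ∀ z ∈ closedBall yg D,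
      deltaMaxW yg Φ Δt y t ≤
        deltaMaxW yg Φ Δt z t + dist y z * Real.exp (K * (t + Δt)) := by
    intro y hy z hz
    refine csSup_image_le_csSup_image_add hIcc (hW_bdd z hz) fun s hs => ⟨s, hs, ?_⟩
    have h₁ := dist_flow_le hK hΦ0 hΦinv hΦderiv hy hz (ht.trans hs.1)
    have h₂ : dist y z * Real.exp (K * s) ≤ dist y z * Real.exp (K * (t + Δt)) := by
      gcongr
      exact hs.2
    have h₃ := dist_triangle_right yg (Φ s y) (Φ s z)
    have h₄ := dist_triangle yg (Φ s z) (Φ s y)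
    rw [dist_comm (Φ s z)] at h₄
    simp only [deltaFn, ← dist_eq_norm]
    linarith
  refine (LipschitzOnWith.of_le_add_mul' (Real.exp (K * (t + Δt))) ?_).continuousOn
  intro d hd d' hd'
  refine csSup_image_le_csSup_image_add (NormedSpace.sphere_nonempty.2 hd.1) ?_ fun y hy => ?_
  · refine ⟨D, ?_⟩
    rintro _ ⟨z, hz, rfl⟩
    exact hW_le z (closedBall_subset_closedBall hd'.2 (sphere_subset_closedBall hz))
  · obtain ⟨z, hz, hyz⟩ := exists_mem_sphere_dist_eq_abs_sub hd'.1 hy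
    refine ⟨z, hz, ?_⟩
    rw [Real.dist_eq, ← hyz, mul_comm]
    exact hW_lip y (closedBall_subset_closedBall hd.2 (sphere_subset_closedBall hy))
      z (closedBall_subset_closedBall hd'.2 (sphere_subset_closedBall hz))
end

section
/- Suppose that: (a) z₀ is strictly increasing on [0, D]; (b) δmax(0, t) = 0 for all t ≥ 0; (c) for every d₀ ∈ (0, D] the map t ↦ β(d₀, t) is strictly decreasing and continuous; and (d) β(d₀, t) → 0 as t → ∞ for every d₀ ∈ [0, D]. Then for each fixed t ≥ 0, the map d₀ ↦ β(d₀, t) is strictly increasing on [0, D]. -/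
open Metric Set Filter Topology

/-- Truncating a `C¹` vector field outside a ball gives a globally Lipschitz, bounded field. -/
theorem exists_lipschitz_bounded_eqOn_closedBall {E : Type*} [NormedAddCommGroup E]
    [InnerProductSpace ℝ E] [FiniteDimensional ℝ E] {f : E → E} (hf : ContDiff ℝ 1 f)
    (c : E) {D : ℝ} (hD : 0 < D) :
    ∃ (g : E → E) (K L : NNReal), LipschitzWith K g ∧ (∀ x, ‖g x‖ ≤ L) ∧
      EqOn g f (closedBall c D) := by
  let χ : ContDiffBump c := ⟨D, D + 1, hD, by linarith⟩
  have hsupp : HasCompactSupport fun x => χ x • f x := χ.hasCompactSupport.smul_right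
  have hdiff : ContDiff ℝ 1 fun x => χ x • f x := χ.contDiff.smul hf
  obtain ⟨K, hK⟩ := ContDiff.lipschitzWith_of_hasCompactSupport hsupp hdiff one_ne_zero
  obtain ⟨L, hL⟩ := hsupp.exists_bound_of_continuous hdiff.continuous
  refine ⟨_, K, L.toNNReal, hK, fun x => (hL x).trans (Real.le_coe_toNNReal L), fun x hx => ?_⟩
  simp [χ.one_of_mem_closedBall hx]

/-- A bounded Lipschitz autonomous field can be integrated backwards from time `T` to time `0`,
with continuous dependence on the terminal value. -/
theorem exists_backward_flow {E : Type*} [NormedAddCommGroup E] [NormedSpace ℝ E]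
    [CompleteSpace E] {g : E → E} {K L : NNReal} (hK : LipschitzWith K g)
    (hL : ∀ x, ‖g x‖ ≤ L) (c : E) {R T : ℝ} (hR : 0 ≤ R) (hT : 0 ≤ T) :
    ∃ A : E → ℝ → E, (∀ x ∈ closedBall c R, A x T = x ∧
      ∀ t ∈ Icc 0 T, HasDerivWithinAt (A x) (g (A x t)) (Icc 0 T) t) ∧
      ContinuousOn (fun x => A x 0) (closedBall c R) := by
  lift R to NNReal using hR
  have hPL : IsPicardLindelof (fun _ => g) (⟨T, hT, le_rfl⟩ : Icc (0 : ℝ) T) c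
      (R + L * T.toNNReal) R L K :=
    { lipschitzOnWith := fun _ _ => hK.lipschitzOnWith
      continuousOn := fun _ _ => continuousOn_const
      norm_le := fun _ _ x _ => hL x
      mul_max_le := by simp [hT] }
  obtain ⟨A, hA, L', hL'⟩ :=
    hPL.exists_forall_mem_closedBall_eq_hasDerivWithinAt_lipschitzOnWith
  exact ⟨A, hA, (hL' 0 ⟨le_rfl, hT⟩).continuousOn⟩

theorem exists_norm_eq_one_smul {E : Type*} [NormedAddCommGroup E] [NormedSpace ℝ E]
    [Nontrivial E] (x : E) : ∃ v : E, ‖v‖ = 1 ∧ x = ‖x‖ • v := by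
  rcases eq_or_ne x 0 with rfl | hx
  · obtain ⟨v, hv⟩ := exists_norm_eq E zero_le_one
    exact ⟨v, hv, by simp⟩
  · have h : ‖x‖ ≠ 0 := norm_ne_zero_iff.2 hx
    exact ⟨‖x‖⁻¹ • x, by simp [norm_smul, h], by simp [smul_smul, h]⟩

/-- Among trajectories starting in a ball, the distance to the centre at a given time is dominated
by trajectories starting on the bounding sphere. -/
theorem exists_mem_sphere_norm_le_norm_flow {E : Type*} [NormedAddCommGroup E]
    [InnerProductSpace ℝ E] [FiniteDimensional ℝ E] [Nontrivial E]
    {c : E} {D : ℝ} (hD : 0 < D) {f : E → E} (hf : ContDiff ℝ 1 f) {Φ : ℝ → E → E}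
    (hΦ0 : ∀ y ∈ closedBall c D, Φ 0 y = y)
    (hΦinv : ∀ t : ℝ, 0 ≤ t → ∀ y ∈ closedBall c D, Φ t y ∈ closedBall c D)
    (hΦderiv : ∀ t : ℝ, 0 ≤ t → ∀ y ∈ closedBall c D,
      HasDerivAt (fun τ => Φ τ y) (f (Φ t y)) t)
    {d T : ℝ} (hd : d ≤ D) (hT : 0 ≤ T) {y : E} (hy : y ∈ closedBall c d) :
    ∃ y' ∈ sphere c d, ‖c - Φ T y‖ ≤ ‖c - Φ T y'‖ := by
  obtain ⟨g, K, L, hK, hL, hgf⟩ := exists_lipschitz_bounded_eqOn_closedBall hf c hD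
  obtain ⟨A, hA, hAc⟩ := exists_backward_flow hK hL c (R := D + 1) (by linarith) hT
  have hΦg : ∀ t : ℝ, 0 ≤ t → ∀ y ∈ closedBall c D,
      HasDerivAt (fun τ => Φ τ y) (g (Φ t y)) t := fun t ht y hy => by
    rw [hgf (hΦinv t ht y hy)]; exact hΦderiv t ht y hy
  have hΦc : ∀ y ∈ closedBall c D, ContinuousOn (fun τ => Φ τ y) (Icc 0 T) :=
    fun y hy t ht => (hΦg t ht.1 y hy).continuousAt.continuousWithinAt
  have hAcont : ∀ x ∈ closedBall c (D + 1), ContinuousOn (A x) (Icc 0 T) :=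
    fun x hx t ht => ((hA x hx).2 t ht).continuousWithinAt
  have hyD : y ∈ closedBall c D := closedBall_subset_closedBall hd hy
  have hΦA : ∀ x ∈ closedBall c (D + 1), A x 0 ∈ closedBall c D → Φ T (A x 0) = x := by
    intro x hx hx0
    have h := ODE_solution_unique (v := fun _ => g) (K := K) (fun _ => hK) (hΦc _ hx0)
      (fun t ht => (hΦg t ht.1 _ hx0).hasDerivWithinAt) (hAcont x hx)
      (fun t ht => ((hA x hx).2 t (Ico_subset_Icc_self ht)).mono_of_mem_nhdsWithin
        (Icc_mem_nhdsGE_of_mem ht)) (hΦ0 _ hx0)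
    exact (h ⟨hT, le_rfl⟩).trans (hA x hx).1
  have hzD := hΦinv T hT y hyD
  have hz : Φ T y ∈ closedBall c (D + 1) :=
    closedBall_subset_closedBall (by linarith) hzD
  have hAΦ : A (Φ T y) 0 = y := by
    have h := ODE_solution_unique_of_mem_Icc_left (v := fun _ => g) (K := K) (s := fun _ => univ)
      (fun _ _ => hK.lipschitzOnWith) (hAcont _ hz)
      (fun t ht => ((hA _ hz).2 t (Ioc_subset_Icc_self ht)).mono_of_mem_nhdsWithin
        (Icc_mem_nhdsLE_of_mem ht)) (fun _ _ => mem_univ _) (hΦc y hyD)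
      (fun t ht => (hΦg t ht.1.le y hyD).hasDerivWithinAt) (fun _ _ => mem_univ _) (hA _ hz).1
    exact (h ⟨le_rfl, hT⟩).trans (hΦ0 y hyD)
  obtain ⟨v, hv, hzv⟩ := exists_norm_eq_one_smul (Φ T y - c)
  have hn : ‖Φ T y - c‖ ≤ D := by simpa [dist_eq_norm] using hzD
  have hn0 := norm_nonneg (Φ T y - c)
  set n := ‖Φ T y - c‖
  have hp : ∀ ρ ∈ Icc n (D + 1), c + ρ • v ∈ closedBall c (D + 1) := fun ρ hρ => by
    have : |ρ| ≤ D + 1 := by rw [abs_of_nonneg (hn0.trans hρ.1)]; exact hρ.2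
    simpa [dist_eq_norm, norm_smul, hv] using this
  have hpn : c + n • v = Φ T y := by rw [← hzv]; abel
  have hcont : ContinuousOn (fun ρ : ℝ => ‖A (c + ρ • v) 0 - c‖) (Icc n (D + 1)) :=
    ((hAc.comp (by fun_prop : Continuous fun ρ : ℝ => c + ρ • v).continuousOn hp).sub
      continuousOn_const).norm
  have hstart : ‖A (c + n • v) 0 - c‖ ≤ d := by
    rw [hpn, hAΦ]; simpa [dist_eq_norm] using hy
  have hend : d ≤ ‖A (c + (D + 1) • v) 0 - c‖ := by
    by_contra! hlt
    have hmem : A (c + (D + 1) • v) 0 ∈ closedBall c D := by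
      rw [mem_closedBall, dist_eq_norm]; exact hlt.le.trans hd
    have h1 := hΦinv T hT _ hmem
    rw [hΦA _ (hp _ ⟨by linarith, le_rfl⟩) hmem, mem_closedBall, dist_eq_norm,
      add_sub_cancel_left, norm_smul, hv, mul_one, Real.norm_of_nonneg (by linarith)] at h1
    linarith
  obtain ⟨ρ, hρ, hρd⟩ := intermediate_value_Icc (by linarith) hcont ⟨hstart, hend⟩
  have hρs : A (c + ρ • v) 0 ∈ sphere c d := by rw [mem_sphere, dist_eq_norm]; exact hρd
  refine ⟨_, hρs, ?_⟩
  rw [hΦA _ (hp ρ hρ) (closedBall_subset_closedBall hd (sphere_subset_closedBall hρs)),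
    norm_sub_rev c, norm_sub_rev c, add_sub_cancel_left, norm_smul, hv, mul_one,
    Real.norm_of_nonneg (hn0.trans hρ.1)]
  exact hρ.1

theorem sSup_image_le_sSup_image_add {ι : Type*} {s : Set ι} (hs : s.Nonempty) {F G : ι → ℝ}
    {C : ℝ} (hG : BddAbove (G '' s)) (h : ∀ i ∈ s, F i ≤ G i + C) :
    sSup (F '' s) ≤ sSup (G '' s) + C :=
  csSup_le (hs.image F) <| forall_mem_image.2 fun i hi =>
    (h i hi).trans (add_le_add_left (le_csSup hG (mem_image_of_mem G hi)) C)

section Bounds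

variable {m : ℕ} {yg : EuclideanSpace ℝ (Fin m)} {D : ℝ}
  {Φ : ℝ → EuclideanSpace ℝ (Fin m) → EuclideanSpace ℝ (Fin m)}

theorem deltaFn_le (hΦinv : ∀ t : ℝ, 0 ≤ t → ∀ y ∈ closedBall yg D, Φ t y ∈ closedBall yg D)
    {y : EuclideanSpace ℝ (Fin m)} (hy : y ∈ closedBall yg D) {t : ℝ} (ht : 0 ≤ t) :
    deltaFn yg Φ y t ≤ D := by
  simpa [deltaFn, dist_eq_norm, norm_sub_rev] using hΦinv t ht y hy

theorem bddAbove_deltaFn_image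
    (hΦinv : ∀ t : ℝ, 0 ≤ t → ∀ y ∈ closedBall yg D, Φ t y ∈ closedBall yg D)
    {y : EuclideanSpace ℝ (Fin m)} (hy : y ∈ closedBall yg D) {s : Set ℝ} (hs : s ⊆ Ici 0) :
    BddAbove (deltaFn yg Φ y '' s) :=
  ⟨D, forall_mem_image.2 fun _ h => deltaFn_le hΦinv hy (hs h)⟩

theorem bddAbove_deltaMaxW_image
    (hΦinv : ∀ t : ℝ, 0 ≤ t → ∀ y ∈ closedBall yg D, Φ t y ∈ closedBall yg D)
    {Δt d t : ℝ} (hΔt : 0 ≤ Δt) (hd : d ≤ D) (ht : 0 ≤ t) :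
    BddAbove ((fun y => deltaMaxW yg Φ Δt y t) '' sphere yg d) :=
  ⟨D, forall_mem_image.2 fun _ hy => csSup_le ((nonempty_Icc.2 (by linarith)).image _) <|
    forall_mem_image.2 fun _ hs => deltaFn_le hΦinv
      (closedBall_subset_closedBall hd (sphere_subset_closedBall hy)) (ht.trans hs.1)⟩

theorem deltaMaxW_eq_sSup_shift (Δt : ℝ) (y : EuclideanSpace ℝ (Fin m)) (t : ℝ) :
    deltaMaxW yg Φ Δt y t = sSup ((fun u => deltaFn yg Φ y (t + u)) '' Icc 0 Δt) := by
  rw [deltaMaxW, ← image_image (deltaFn yg Φ y) (t + ·), image_const_add_Icc, add_zero]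

/-- Monotonicity of the windowed worst-case distance in the radius of the initial sphere. -/
theorem deltaMax_mono [Nontrivial (EuclideanSpace ℝ (Fin m))] (hD : 0 < D)
    {f : EuclideanSpace ℝ (Fin m) → EuclideanSpace ℝ (Fin m)} (hf : ContDiff ℝ 1 f)
    (hΦ0 : ∀ y ∈ closedBall yg D, Φ 0 y = y)
    (hΦinv : ∀ t : ℝ, 0 ≤ t → ∀ y ∈ closedBall yg D, Φ t y ∈ closedBall yg D)
    (hΦderiv : ∀ t : ℝ, 0 ≤ t → ∀ y ∈ closedBall yg D,
      HasDerivAt (fun τ => Φ τ y) (f (Φ t y)) t)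
    {Δt d₁ d₂ t : ℝ} (hΔt : 0 ≤ Δt) (h0 : 0 ≤ d₁) (h12 : d₁ ≤ d₂) (h2 : d₂ ≤ D) (ht : 0 ≤ t) :
    deltaMax yg Φ Δt d₁ t ≤ deltaMax yg Φ Δt d₂ t := by
  refine csSup_le ((NormedSpace.sphere_nonempty.2 h0).image _) <| forall_mem_image.2 fun y hy =>
    csSup_le ((nonempty_Icc.2 (by linarith)).image _) <| forall_mem_image.2 fun s hs => ?_
  have hs0 : 0 ≤ s := ht.trans hs.1
  obtain ⟨y', hy', hle⟩ := exists_mem_sphere_norm_le_norm_flow hD hf hΦ0 hΦinv hΦderiv h2 hs0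
    (closedBall_subset_closedBall h12 (sphere_subset_closedBall hy))
  have hbdd := bddAbove_deltaFn_image hΦinv
    (closedBall_subset_closedBall h2 (sphere_subset_closedBall hy'))
    (s := Icc t (t + Δt)) fun _ h => ht.trans h.1
  calc deltaFn yg Φ y s ≤ deltaFn yg Φ y' s := hle
    _ ≤ deltaMaxW yg Φ Δt y' t := le_csSup hbdd (mem_image_of_mem _ hs)
    _ ≤ deltaMax yg Φ Δt d₂ t :=
      le_csSup (bddAbove_deltaMaxW_image hΦinv hΔt h2 ht) (mem_image_of_mem _ hy')

theorem deltaMax_continuousOn [Nontrivial (EuclideanSpace ℝ (Fin m))]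
    {f : EuclideanSpace ℝ (Fin m) → EuclideanSpace ℝ (Fin m)} (hf : Continuous f)
    (hΦinv : ∀ t : ℝ, 0 ≤ t → ∀ y ∈ closedBall yg D, Φ t y ∈ closedBall yg D)
    (hΦderiv : ∀ t : ℝ, 0 ≤ t → ∀ y ∈ closedBall yg D,
      HasDerivAt (fun τ => Φ τ y) (f (Φ t y)) t)
    {Δt d : ℝ} (hΔt : 0 ≤ Δt) (h0 : 0 ≤ d) (hd : d ≤ D) :
    ContinuousOn (deltaMax yg Φ Δt d) (Ici 0) := by
  obtain ⟨L, hL⟩ := (isCompact_closedBall yg D).exists_bound_of_continuousOn hf.continuousOn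
  have hδ : ∀ y ∈ closedBall yg D, ∀ t ∈ Ici (0 : ℝ), ∀ s ∈ Ici (0 : ℝ),
      deltaFn yg Φ y t ≤ deltaFn yg Φ y s + L * |t - s| := by
    intro y hy t ht s hs
    have h := (convex_Ici (0 : ℝ)).norm_image_sub_le_of_norm_hasDerivWithin_le
      (fun x hx => (hΦderiv x hx y hy).hasDerivWithinAt)
      (fun x hx => hL _ (hΦinv x hx y hy)) ht hs
    have h' := norm_sub_le_norm_sub_add_norm_sub yg (Φ s y) (Φ t y)
    rw [Real.norm_eq_abs, abs_sub_comm] at h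
    unfold deltaFn
    linarith
  have hlip : ∀ t ∈ Ici (0 : ℝ), ∀ s ∈ Ici (0 : ℝ),
      deltaMax yg Φ Δt d t ≤ deltaMax yg Φ Δt d s + L * |t - s| := by
    intro t ht s hs
    refine sSup_image_le_sSup_image_add (NormedSpace.sphere_nonempty.2 h0)
      (bddAbove_deltaMaxW_image hΦinv hΔt hd hs) fun y hy => ?_
    have hyD := closedBall_subset_closedBall hd (sphere_subset_closedBall hy)
    rw [deltaMaxW_eq_sSup_shift, deltaMaxW_eq_sSup_shift]
    refine sSup_image_le_sSup_image_add (nonempty_Icc.2 hΔt)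
      ⟨D, forall_mem_image.2 fun u hu => deltaFn_le hΦinv hyD (add_nonneg hs hu.1)⟩
      fun u hu => ?_
    simpa using hδ y hyD (t + u) (add_nonneg ht hu.1) (s + u) (add_nonneg hs hu.1)
  exact (LipschitzOnWith.of_le_add_mul' L hlip).continuousOn

end Bounds

theorem stmt_17
    (m : ℕ) (hm : 1 ≤ m)
    (yg : EuclideanSpace ℝ (Fin m)) (D : ℝ) (hD : 0 < D)
    (f : EuclideanSpace ℝ (Fin m) → EuclideanSpace ℝ (Fin m))
    (hf : ContDiff ℝ 1 f)
    (Φ : ℝ → EuclideanSpace ℝ (Fin m) → EuclideanSpace ℝ (Fin m))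
    (hΦ0 : ∀ y₀ ∈ Metric.closedBall yg D, Φ 0 y₀ = y₀)
    (hΦinv : ∀ t : ℝ, 0 ≤ t → ∀ y₀ ∈ Metric.closedBall yg D,
      Φ t y₀ ∈ Metric.closedBall yg D)
    (hΦderiv : ∀ t : ℝ, 0 ≤ t → ∀ y₀ ∈ Metric.closedBall yg D,
      HasDerivAt (fun τ => Φ τ y₀) (f (Φ t y₀)) t)
    (hΦflow : ∀ s : ℝ, 0 ≤ s → ∀ t : ℝ, 0 ≤ t → ∀ y₀ ∈ Metric.closedBall yg D,
      Φ (s + t) y₀ = Φ t (Φ s y₀))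
    (Δt : ℝ) (hΔt : 0 < Δt) (α : ℝ) (hα : α < 0)
    (ha : StrictMonoOn (fun d₀ => deltaMax yg Φ Δt d₀ 0 + d₀) (Set.Icc 0 D))
    (hb : ∀ t : ℝ, 0 ≤ t → deltaMax yg Φ Δt 0 t = 0)
    (hc : ∀ d₀ ∈ Set.Ioc (0:ℝ) D,
      StrictAntiOn (fun t => betaFn yg Φ Δt α d₀ t) (Set.Ici 0) ∧
      ContinuousOn (fun t => betaFn yg Φ Δt α d₀ t) (Set.Ici 0))
    (hd : ∀ d₀ ∈ Set.Icc (0:ℝ) D,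
      Filter.Tendsto (fun t => betaFn yg Φ Δt α d₀ t) Filter.atTop (𝓝 0)) :
    ∀ t : ℝ, 0 ≤ t →
      StrictMonoOn (fun d₀ => betaFn yg Φ Δt α d₀ t) (Set.Icc 0 D) := by
  have : Nonempty (Fin m) := ⟨⟨0, hm⟩⟩
  intro t ht d₁ h₁ d₂ h₂ h12
  have hint : ∀ d ∈ Icc (0 : ℝ) D, IntervalIntegrable
      (fun s => Real.exp (α * (t - s)) * deltaMax yg Φ Δt d s) MeasureTheory.volume 0 t := by
    intro d hd
    refine ContinuousOn.intervalIntegrable_of_Icc ht (ContinuousOn.mul (by fun_prop) ?_)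
    exact (deltaMax_continuousOn hf.continuous hΦinv hΦderiv hΔt.le hd.1 hd.2).mono
      Icc_subset_Ici_self
  have hI := intervalIntegral.integral_mono_on ht (hint d₁ h₁) (hint d₂ h₂) fun s hs =>
    mul_le_mul_of_nonneg_left
      (deltaMax_mono hD hf hΦ0 hΦinv hΦderiv hΔt.le h₁.1 h12.le h₂.2 hs.1)
      (Real.exp_pos (α * (t - s))).le
  have hz := mul_lt_mul_of_pos_left (ha h₁ h₂ h12) (Real.exp_pos (α * t))
  have hαI := mul_le_mul_of_nonpos_left hI hα.le
  simp only [betaFn]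
  linarith
end
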